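/- arXiv:2508.21509 — 6 statements merged into one kernel-verified Lean document; each statement's English description precedes it below -/
import Mathlib

section
/- Let n ≥ 3 be odd and let P be an n-cycle sign pattern with 0-diagonal in standard labeling. If P allows singularity, i.e., there exists B ∈ Q(P) with det B = 0, then P does not require a unique inertia: there exist B₁, B₂ ∈ Q(P) with In(B₁) ≠ In(B₂). -/
open Polynomial Matrix

def QClass {n : ℕ} (P : Matrix (Fin n) (Fin n) SignType) (B : Matrix (Fin n) (Fin n) ℝ) : Prop :=
  ∀ i j, SignType.sign (B i j) = P i j

noncomputable def charRoots {n : ℕ} (B : Matrix (Fin n) (Fin n) ℝ) : Multiset ℂ :=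
  ((B.charpoly).map (algebraMap ℝ ℂ)).roots

noncomputable def inertia {n : ℕ} (B : Matrix (Fin n) (Fin n) ℝ) : ℕ × ℕ × ℕ :=
  (((charRoots B).filter (fun z => 0 < z.re)).card,
   ((charRoots B).filter (fun z => z.re < 0)).card,
   ((charRoots B).filter (fun z => z.re = 0)).card)

/-- For a real monic polynomial not vanishing at `0`, the sign of its value at `0` is the parity
of the number of its complex roots in the open right half-plane. -/
theorem neg_one_pow_card_roots_re_pos_mul_eval_zero_pos (p : ℝ[X]) (hp : p.Monic)
    (h0 : p.eval 0 ≠ 0) :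
    0 < (-1 : ℝ) ^ (((p.map (algebraMap ℝ ℂ)).roots.filter (fun z => 0 < z.re)).card) *
      p.eval 0 := by
  induction hd : p.natDegree using Nat.strong_induction_on generalizing p with
  | _ d ih =>
  have key : ∀ q r : ℝ[X], p = q * r → q.Monic → 0 < q.natDegree →
      0 < (-1 : ℝ) ^ (((q.map (algebraMap ℝ ℂ)).roots.filter (fun z => 0 < z.re)).card) *
        q.eval 0 →
      0 < (-1 : ℝ) ^ (((p.map (algebraMap ℝ ℂ)).roots.filter (fun z => 0 < z.re)).card) *
        p.eval 0 := by
    intro q r hpqr hq hqd hqs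
    have hr : r.Monic := hq.of_mul_monic_left (hpqr ▸ hp)
    have hr0 : r.eval 0 ≠ 0 := by
      intro h
      exact h0 (by rw [hpqr, eval_mul, h, mul_zero])
    have hdeg : r.natDegree < d := by
      rw [← hd, hpqr, hq.natDegree_mul hr]
      omega
    have hrs := ih _ hdeg r hr hr0 rfl
    have hne : q.map (algebraMap ℝ ℂ) * r.map (algebraMap ℝ ℂ) ≠ 0 :=
      ((hq.map _).mul (hr.map _)).ne_zero
    rw [hpqr, Polynomial.map_mul, roots_mul hne, Multiset.filter_add, Multiset.card_add, pow_add,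
      eval_mul]
    refine (mul_pos hqs hrs).trans_eq ?_
    ring
  rcases Nat.eq_zero_or_pos p.natDegree with hz | hpos
  · rw [hp.natDegree_eq_zero.mp hz]
    simp
  · obtain ⟨z, hz⟩ := IsAlgClosed.exists_aeval_eq_zero ℂ p (natDegree_pos_iff_degree_pos.mp hpos).ne'
    by_cases him : z.im = 0
    · have hzr : z = algebraMap ℝ ℂ z.re := Complex.ext (by simp) (by simp [him])
      have hroot : p.eval z.re = 0 := by
        rw [hzr, aeval_algebraMap_apply] at hz
        simpa using hz
      obtain ⟨r, hr⟩ := dvd_iff_isRoot.mpr hroot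
      have hre : z.re ≠ 0 := by
        intro h
        exact h0 (h ▸ hroot)
      refine key _ r hr (monic_X_sub_C _) (by simp) ?_
      rw [Polynomial.map_sub, map_X, map_C, roots_X_sub_C]
      rcases hre.lt_or_gt with h | h
      · simp [Multiset.filter_singleton, h.not_gt, h]
      · simp [Multiset.filter_singleton, h]
    · obtain ⟨r, hr⟩ := quadratic_dvd_of_aeval_eq_zero_im_ne_zero p hz him
      have hform : (X ^ 2 - C (2 * z.re) * X + C (‖z‖ ^ 2) : ℝ[X]) =
          X ^ 2 + (C (-(2 * z.re)) * X + C (‖z‖ ^ 2)) := by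
        rw [C_neg]; ring
      have hlt : (C (-(2 * z.re)) * X + C (‖z‖ ^ 2) : ℝ[X]).degree < 2 :=
        degree_linear_lt
      have hmap : (X ^ 2 - C (2 * z.re) * X + C (‖z‖ ^ 2) : ℝ[X]).map (algebraMap ℝ ℂ) =
          (X - C z) * (X - C (starRingEnd ℂ z)) := by
        have h1 : ((2 * z.re : ℝ) : ℂ) = z + starRingEnd ℂ z := (Complex.add_conj z).symm
        have h2 : ((‖z‖ ^ 2 : ℝ) : ℂ) = z * starRingEnd ℂ z := by
          rw [Complex.mul_conj, Complex.normSq_eq_norm_sq]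
        simp only [Polynomial.map_add, Polynomial.map_sub, Polynomial.map_mul, Polynomial.map_pow,
          map_X, map_C, Complex.coe_algebraMap, h1, h2]
        rw [C_add, C_mul]
        ring
      refine key _ r hr ?_ ?_ ?_
      · rw [hform]
        exact monic_X_pow_add hlt
      · rw [hform, natDegree_eq_of_degree_eq_some (n := 2) ?_]
        · norm_num
        · rw [degree_add_eq_left_of_degree_lt (by simpa using hlt)]
          simp
      · have hz0 : 0 < ‖z‖ := norm_pos_iff.mpr (by rintro rfl; simp at him)
        rw [hmap, roots_mul ((monic_X_sub_C _).mul (monic_X_sub_C _)).ne_zero, roots_X_sub_C,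
          roots_X_sub_C, Multiset.filter_add, Multiset.filter_singleton,
          Multiset.filter_singleton]
        by_cases h : 0 < z.re <;> simp [h, hz0]

theorem inertia_ne_of_det_mul_det_neg {n : ℕ} {A B : Matrix (Fin n) (Fin n) ℝ}
    (h : A.det * B.det < 0) : inertia A ≠ inertia B := by
  intro he
  have eval_eq : ∀ M : Matrix (Fin n) (Fin n) ℝ, M.charpoly.eval 0 = (-1) ^ n * M.det := by
    intro M
    rw [M.det_eq_sign_charpoly_coeff, ← coeff_zero_eq_eval_zero, Fintype.card_fin, ← mul_assoc,
      ← mul_pow]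
    simp
  have hA : A.det ≠ 0 := left_ne_zero_of_mul h.ne
  have hB : B.det ≠ 0 := right_ne_zero_of_mul h.ne
  have pA := neg_one_pow_card_roots_re_pos_mul_eval_zero_pos A.charpoly A.charpoly_monic
    (by simp [eval_eq, hA])
  have pB := neg_one_pow_card_roots_re_pos_mul_eval_zero_pos B.charpoly B.charpoly_monic
    (by simp [eval_eq, hB])
  have hc : ((A.charpoly.map (algebraMap ℝ ℂ)).roots.filter (fun z => 0 < z.re)).card =
      ((B.charpoly.map (algebraMap ℝ ℂ)).roots.filter (fun z => 0 < z.re)).card :=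
    congrArg Prod.fst he
  rw [hc] at pA
  rw [eval_eq] at pA pB
  have hprod := mul_pos pA pB
  set k := ((B.charpoly.map (algebraMap ℝ ℂ)).roots.filter (fun z => 0 < z.re)).card
  have hs : ∀ m : ℕ, ((-1 : ℝ) ^ m) * (-1) ^ m = 1 := by
    intro m
    rw [← mul_pow]
    simp
  have : (-1 : ℝ) ^ k * ((-1) ^ n * A.det) * ((-1) ^ k * ((-1) ^ n * B.det)) =
      A.det * B.det := by
    linear_combination (A.det * B.det) * ((-1) ^ n * (-1) ^ n) * hs k + A.det * B.det * hs n
  linarith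

/-- The nonzero entries of `B` are exactly those at positions `(i, i + 1)` and `(i, i - 1)`,
indices being cyclic. -/
def IsCycleMatrix {n : ℕ} [NeZero n] (B : Matrix (Fin n) (Fin n) ℝ) : Prop :=
  ∀ i j, B i j ≠ 0 ↔ (j = i + 1 ∨ j = i - 1)

theorem Fin.add_one_ne_sub_one {n : ℕ} [NeZero n] (hn : 3 ≤ n) (i : Fin n) :
    i + 1 ≠ i - 1 := by
  intro h
  have h2 : (1 : Fin n) + 1 = 0 := by
    have := congrArg (fun x => x - i + 1) h
    simpa using this
  have := congrArg Fin.val h2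
  rw [Fin.val_add, Fin.val_one', Fin.val_zero, Nat.mod_eq_of_lt (by omega : 1 < n),
    Nat.mod_eq_of_lt (by omega)] at this
  omega

theorem Fin.exists_eq_add_nsmul_one {n : ℕ} [NeZero n] (i j : Fin n) :
    ∃ k : ℕ, j = i + k • (1 : Fin n) := by
  have hval : ∀ k : ℕ, (k • (1 : Fin n)).val = k % n := by
    intro k
    induction k with
    | zero => simp
    | succ k ih => rw [succ_nsmul, Fin.val_add, ih, Fin.val_one', ← Nat.add_mod]
  refine ⟨(j - i).val, ?_⟩
  rw [Fin.ext (hval (j - i).val |>.trans (Nat.mod_eq_of_lt (j - i).isLt))]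
  abel

theorem Fin.forall_of_add_two {n : ℕ} [NeZero n] (hodd : Odd n) {p : Fin n → Prop}
    (hstep : ∀ i, p i → p (i + 1 + 1)) {i : Fin n} (hi : p i) (j : Fin n) : p j := by
  have hiter : ∀ (k : ℕ) (i : Fin n), p i → p (i + k • (1 + 1)) := by
    intro k
    induction k with
    | zero => intro i hi; simpa using hi
    | succ k ih =>
      intro i hi
      rw [succ_nsmul, ← add_assoc, ← add_assoc]
      exact hstep _ (ih i hi)
  obtain ⟨m, hm⟩ := hodd
  have hn1 : n • (1 : Fin n) = 0 := by
    simpa using card_nsmul_eq_zero (G := Fin n) (x := 1)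
  have hone : ((m + 1) • (1 + 1) : Fin n) = 1 := by
    have : ((m + 1) • (1 + 1) : Fin n) = (2 * m + 1) • 1 + 1 := by
      rw [← two_nsmul, ← mul_nsmul', ← succ_nsmul]
      congr 1
      ring
    rw [this, ← hm, hn1, zero_add]
  have hsucc : ∀ i, p i → p (i + 1) := by
    intro i hi
    simpa only [hone] using hiter (m + 1) i hi
  obtain ⟨k, rfl⟩ := Fin.exists_eq_add_nsmul_one i j
  induction k with
  | zero => simpa using hi
  | succ k ih =>
    rw [succ_nsmul, ← add_assoc]
    exact hsucc _ ih

theorem IsCycleMatrix.prod_eq_neg_prod_of_det_eq_zero {n : ℕ} [NeZero n] (hn : 3 ≤ n)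
    (hodd : Odd n) {B : Matrix (Fin n) (Fin n) ℝ} (hB : IsCycleMatrix B) (hdet : B.det = 0) :
    ∏ i, B i (i + 1) = -∏ i, B i (i - 1) := by
  obtain ⟨v, hv, hBv⟩ := Matrix.exists_mulVec_eq_zero_iff.mpr hdet
  have heq : ∀ i, B i (i + 1) * v (i + 1) = -(B i (i - 1) * v (i - 1)) := by
    intro i
    have h := congrFun hBv i
    rw [Matrix.mulVec, dotProduct, Finset.sum_eq_add (i + 1) (i - 1)
      (Fin.add_one_ne_sub_one hn i) ?_ (by simp) (by simp)] at h
    · exact eq_neg_of_add_eq_zero_left h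
    · rintro j - ⟨h1, h2⟩
      have : B i j = 0 := by
        by_contra hne
        exact ((hB i j).mp hne).elim h1 h2
      rw [this, zero_mul]
  have hne : ∀ i, v i ≠ 0 := by
    intro i hi
    apply hv
    funext j
    refine Fin.forall_of_add_two hodd (p := fun i => v i = 0) (fun i hi => ?_) hi j
    have h := heq (i + 1)
    rw [add_sub_cancel_right, hi, mul_zero, neg_zero] at h
    exact (mul_eq_zero.mp h).resolve_left ((hB _ _).mpr (Or.inl rfl))
  have hadd : ∏ i, v (i + 1) = ∏ i, v i := Equiv.prod_comp (Equiv.addRight 1) v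
  have hsub : ∏ i, v (i - 1) = ∏ i, v i := Equiv.prod_comp (Equiv.subRight 1) v
  have hp : ∏ i, B i (i + 1) * v (i + 1) = ∏ i, -(B i (i - 1) * v (i - 1)) :=
    Finset.prod_congr rfl fun i _ => heq i
  rw [Finset.prod_neg, Finset.card_univ, Fintype.card_fin, hodd.neg_one_pow,
    Finset.prod_mul_distrib, Finset.prod_mul_distrib,
    hadd, hsub] at hp
  have hv0 : ∏ i, v i ≠ 0 := Finset.prod_ne_zero_iff.mpr fun i _ => hne i
  apply mul_right_cancel₀ hv0
  linear_combination hp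

/-- Scale the entry `(0, 1)` of `B` by `t`. -/
noncomputable def scaleEntry {n : ℕ} [NeZero n] (B : Matrix (Fin n) (Fin n) ℝ) (t : ℝ) :
    Matrix (Fin n) (Fin n) ℝ :=
  B.updateRow 0 (B 0 + (t - 1) • Pi.single 1 (B 0 1))

theorem scaleEntry_apply {n : ℕ} [NeZero n] (B : Matrix (Fin n) (Fin n) ℝ) (t : ℝ)
    (i j : Fin n) : scaleEntry B t i j = (if i = 0 ∧ j = 1 then t else 1) * B i j := by
  unfold scaleEntry
  by_cases hi : i = 0
  · subst hi
    by_cases hj : j = 1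
    · subst hj
      simp
      ring
    · simp [hj]
  · simp [hi]

theorem det_scaleEntry {n : ℕ} [NeZero n] (B : Matrix (Fin n) (Fin n) ℝ) (t : ℝ) :
    (scaleEntry B t).det =
      B.det + (t - 1) * (B.updateRow 0 (Pi.single 1 (B 0 1))).det := by
  rw [scaleEntry, det_updateRow_add, det_updateRow_smul, updateRow_eq_self]

theorem QClass.scaleEntry {n : ℕ} [NeZero n] {P : Matrix (Fin n) (Fin n) SignType}
    {B : Matrix (Fin n) (Fin n) ℝ} (hB : QClass P B) {t : ℝ} (ht : 0 < t) :
    QClass P (scaleEntry B t) := by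
  intro i j
  rw [scaleEntry_apply, sign_mul, hB i j]
  split_ifs <;> simp [ht]

theorem IsCycleMatrix.det_scaleEntry_two_ne_zero {n : ℕ} [NeZero n] (hn : 3 ≤ n)
    (hodd : Odd n) {B : Matrix (Fin n) (Fin n) ℝ} (hB : IsCycleMatrix B) (hdet : B.det = 0) :
    (scaleEntry B 2).det ≠ 0 := by
  intro hdet2
  have hB2 : IsCycleMatrix (scaleEntry B 2) := by
    intro i j
    rw [← hB i j, scaleEntry_apply]
    split_ifs <;> simp
  have h1 := hB.prod_eq_neg_prod_of_det_eq_zero hn hodd hdet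
  have h2 := hB2.prod_eq_neg_prod_of_det_eq_zero hn hodd hdet2
  have hfwd : ∏ i, scaleEntry B 2 i (i + 1) = 2 * ∏ i, B i (i + 1) := by
    simp_rw [scaleEntry_apply]
    rw [Finset.prod_mul_distrib]
    congr 1
    rw [Finset.prod_eq_single 0] <;> simp +contextual
  have hbwd : ∏ i, scaleEntry B 2 i (i - 1) = ∏ i, B i (i - 1) := by
    refine Finset.prod_congr rfl fun i _ => ?_
    rw [scaleEntry_apply, if_neg, one_mul]
    rintro ⟨rfl, h⟩
    exact Fin.add_one_ne_sub_one hn (0 : Fin n) (by rw [h, zero_add])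
  rw [hfwd, hbwd] at h2
  have hne : ∏ i, B i (i + 1) ≠ 0 :=
    Finset.prod_ne_zero_iff.mpr fun i _ => (hB _ _).mpr (Or.inl rfl)
  exact hne (by linarith)

/-- An `n`-cycle sign pattern with `0`-diagonal (`n ≥ 3` odd, standard labeling) that allows
singularity does not require a unique inertia. -/
theorem odd_cycle_allows_singularity_not_unique_inertia (n : ℕ) (hn : 3 ≤ n) (hodd : Odd n)
    (P : Matrix (Fin n) (Fin n) SignType)
    (hcyc : ∀ i j : Fin n, P i j ≠ 0 ↔
      (((i : ℕ) + 1) % n = j ∨ ((j : ℕ) + 1) % n = i))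
    (hsing : ∃ B, QClass P B ∧ B.det = 0) :
    ∃ B₁ B₂, QClass P B₁ ∧ QClass P B₂ ∧ inertia B₁ ≠ inertia B₂ := by
  have : NeZero n := ⟨by omega⟩
  obtain ⟨B, hB, hdet⟩ := hsing
  have hval : ∀ i j : Fin n, ((i : ℕ) + 1) % n = j ↔ j = i + 1 := by
    intro i j
    rw [eq_comm, Fin.ext_iff, Fin.val_add, Fin.val_one', Nat.add_mod_mod]
  have hcycle : IsCycleMatrix B := by
    intro i j
    rw [← sign_ne_zero, hB i j, hcyc i j, hval, hval, eq_sub_iff_add_eq, eq_comm (a := i)]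
  have hne := hcycle.det_scaleEntry_two_ne_zero hn hodd hdet
  refine ⟨scaleEntry B 2, scaleEntry B (1 / 2), hB.scaleEntry (by norm_num),
    hB.scaleEntry (by norm_num), inertia_ne_of_det_mul_det_neg ?_⟩
  rw [det_scaleEntry, hdet] at hne ⊢
  rw [det_scaleEntry, hdet]
  have := sq_pos_of_ne_zero hne
  nlinarith
end

section
/- Let n ≥ 3 be odd and let P be an n-cycle sign pattern with 0-diagonal in standard labeling. If P is sign nonsingular, i.e., det B ≠ 0 for every B ∈ Q(P), then P requires a unique inertia. -/
open Polynomial Matrix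

def RequiresUniqueInertia {n : ℕ} (P : Matrix (Fin n) (Fin n) SignType) : Prop :=
  ∀ B₁ B₂, QClass P B₁ → QClass P B₂ → inertia B₁ = inertia B₂

section NearCyclicPermutations

variable {α : Type*} {c σ : Equiv.Perm α}

/-- If `σ` moves every point at most one step forwards or backwards along the cycle `c`, and
moves `i` and then `c i` one step forwards, then it agrees with `c`. -/
lemma eq_of_two_forward_steps (hc : ∀ i j, ∃ k : ℕ, (c ^ k) i = j) (hc₁ : ∀ i, c i ≠ i)
    (hσ : ∀ i, σ i = i ∨ σ i = c i ∨ c (σ i) = i) {i : α} (h₁ : σ i = c i)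
    (h₂ : σ (c i) = c (c i)) : σ = c := by
  have key : ∀ k : ℕ, σ ((c ^ k) i) = c ((c ^ k) i) ∧ σ (c ((c ^ k) i)) = c (c ((c ^ k) i)) := by
    intro k
    induction k with
    | zero => exact ⟨h₁, h₂⟩
    | succ k ih =>
      rw [pow_succ', Equiv.Perm.mul_apply]
      set j := (c ^ k) i
      obtain ⟨ih₁, ih₂⟩ := ih
      refine ⟨ih₂, ?_⟩
      rcases hσ (c (c j)) with h | h | h
      · exact absurd (σ.injective (h.trans ih₂.symm)) (hc₁ _)
      · exact h
      · have hj : c (c j) = j := σ.injective ((c.injective h).trans ih₁.symm)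
        rw [hj, ih₁]
  ext j
  obtain ⟨k, rfl⟩ := hc i j
  rw [(key k).1]

/-- A permutation moving every point at most one step along a cycle of length at least three is an
involution or has no fixed point. -/
lemma sq_eq_one_or_forall_ne (hc : ∀ i j, ∃ k : ℕ, (c ^ k) i = j)
    (hc' : ∀ i j, ∃ k : ℕ, (c⁻¹ ^ k) i = j) (hc₁ : ∀ i, c i ≠ i)
    (hσ : ∀ i, σ i = i ∨ σ i = c i ∨ c (σ i) = i) : σ ^ 2 = 1 ∨ ∀ i, σ i ≠ i := by
  by_cases hinv : σ ^ 2 = 1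
  · exact Or.inl hinv
  right
  obtain ⟨i, hi⟩ : ∃ i, σ (σ i) ≠ i := by
    by_contra! h
    exact hinv (Equiv.ext fun i => by simpa [pow_two] using h i)
  rcases hσ i with h | h | h
  · exact absurd (by rw [h, h]) hi
  · have h₂ : σ (c i) = c (c i) := by
      rw [← h]
      rcases hσ (σ i) with h' | h' | h'
      · exact absurd (σ.injective h') (by rw [h]; exact hc₁ i)
      · exact h'
      · rw [h] at h' ⊢
        exact absurd (c.injective h') (by rw [← h]; exact hi)
    rw [eq_of_two_forward_steps hc hc₁ hσ h h₂]
    exact hc₁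
  · have hσ' : ∀ i, σ i = i ∨ σ i = c⁻¹ i ∨ c⁻¹ (σ i) = i := fun i => by
      rw [Equiv.Perm.eq_inv_iff_eq, Equiv.Perm.inv_eq_iff_eq]
      have := hσ i
      tauto
    have hc₁' : ∀ i, c⁻¹ i ≠ i := fun i h => by
      rw [Equiv.Perm.inv_eq_iff_eq] at h
      exact hc₁ i h.symm
    have h₁ : σ i = c⁻¹ i := by rwa [Equiv.Perm.eq_inv_iff_eq]
    have h₂ : σ (c⁻¹ i) = c⁻¹ (c⁻¹ i) := by
      rw [← h₁]
      rcases hσ' (σ i) with h' | h' | h'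
      · exact absurd (σ.injective h') (by rw [h₁]; exact hc₁' i)
      · exact h'
      · rw [h₁] at h' ⊢
        exact absurd (c⁻¹.injective h') (by rw [← h₁]; exact hi)
    rw [eq_of_two_forward_steps hc' hc₁' hσ' h₁ h₂]
    exact hc₁'

end NearCyclicPermutations

/-- For a matrix of odd order supported on a cycle, the part of `det (x + B)` which is odd in `B`
is `det B`. -/
lemma det_scalar_add_sub_det_scalar_sub {α R : Type*} [Fintype α] [DecidableEq α] [CommRing R]
    {c : Equiv.Perm α} (hodd : Odd (Fintype.card α)) (hc : ∀ i j, ∃ k : ℕ, (c ^ k) i = j)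
    (hc' : ∀ i j, ∃ k : ℕ, (c⁻¹ ^ k) i = j) (hc₁ : ∀ i, c i ≠ i) {B : Matrix α α R}
    (hdiag : ∀ i, B i i = 0) (hB : ∀ i j, B i j ≠ 0 → c i = j ∨ c j = i) (x : R) :
    (scalar α x + B).det - (scalar α x - B).det = 2 * B.det := by
  have hneg : (-B).det = -B.det := by rw [det_neg, hodd.neg_one_pow, neg_one_mul]
  suffices h : (scalar α x + B).det - (scalar α x - B).det = B.det - (-B).det by
    rw [h, hneg]; ring
  simp only [det_apply', ← Finset.sum_sub_distrib, ← mul_sub]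
  refine Finset.sum_congr rfl fun σ _ => ?_
  congr 1
  by_cases hσ : ∀ i, σ i = i ∨ σ i = c i ∨ c (σ i) = i
  · rcases sq_eq_one_or_forall_ne hc hc' hc₁ hσ with h | h
    · have hprod : ∀ A : Matrix α α R, (∀ i, A i i = 0) → ∀ y : R,
          ∏ i, (scalar α y - A) (σ i) i = ∏ i, (scalar α y + A) (σ i) i := by
        intro A hA y
        have hterm : ∀ i, (scalar α y - A) (σ i) i =
            (if σ i ≠ i then -1 else 1) * (scalar α y + A) (σ i) i := by
          intro i
          by_cases hi : σ i = i <;> simp [hi, hA]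
        have hcard : Even (Finset.univ.filter fun i => σ i ≠ i).card :=
          even_iff_two_dvd.2 (Equiv.Perm.two_dvd_card_support h)
        rw [Finset.prod_congr rfl fun i _ => hterm i, Finset.prod_mul_distrib, Finset.prod_ite]
        simp [hcard.neg_one_pow]
      have h₀ := hprod B hdiag 0
      simp only [map_zero, zero_sub, zero_add] at h₀
      rw [hprod B hdiag x, h₀]
      simp
    · have hterm : ∀ i, (scalar α x) (σ i) i = 0 := fun i => by simp [h i]
      simp only [Matrix.add_apply, Matrix.sub_apply, Matrix.neg_apply, hterm, zero_add, zero_sub]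
  · push Not at hσ
    obtain ⟨i, hi₁, hi₂, hi₃⟩ := hσ
    have hBi : B (σ i) i = 0 := by
      by_contra h
      rcases hB _ _ h with h | h
      · exact hi₃ h
      · exact hi₂ h.symm
    rw [Finset.prod_eq_zero (Finset.mem_univ i), Finset.prod_eq_zero (Finset.mem_univ i),
      Finset.prod_eq_zero (Finset.mem_univ i), Finset.prod_eq_zero (Finset.mem_univ i)] <;>
    simp [hBi, hi₁]

/-- A nonsingular real matrix of odd order has no purely imaginary eigenvalue if the part of
`det (x + B)` which is odd in `B` is `det B`. -/
lemma re_ne_zero_of_det_scalar_add_sub {n : ℕ} {B : Matrix (Fin n) (Fin n) ℝ}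
    (hdet : B.det ≠ 0) (hodd : Odd n)
    (h : ∀ x : ℂ, (scalar (Fin n) x + B.map (algebraMap ℝ ℂ)).det -
      (scalar (Fin n) x - B.map (algebraMap ℝ ℂ)).det = 2 * (B.map (algebraMap ℝ ℂ)).det)
    {z : ℂ} (hz : z ∈ charRoots B) : z.re ≠ 0 := by
  intro hre
  have hroot : (B.charpoly.map (algebraMap ℝ ℂ)).eval z = 0 := (mem_roots'.1 hz).2
  have hconj : -z = starRingEnd ℂ z := by
    apply Complex.ext <;> simp [hre]
  have hroot' : (B.charpoly.map (algebraMap ℝ ℂ)).eval (-z) = 0 := by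
    rw [eval_map_algebraMap] at hroot ⊢
    rw [hconj, aeval_conj, hroot, map_zero]
  rw [← charpoly_map, eval_charpoly] at hroot hroot'
  have hneg : scalar (Fin n) (-z) - B.map (algebraMap ℝ ℂ) =
      -(scalar (Fin n) z + B.map (algebraMap ℝ ℂ)) := by
    rw [map_neg]; abel
  rw [hneg, det_neg, Fintype.card_fin, hodd.neg_one_pow, neg_one_mul, neg_eq_zero] at hroot'
  have hB := h z
  rw [hroot, hroot', sub_zero, zero_eq_mul] at hB
  rcases hB with hB | hB
  · norm_num at hB
  · have : (B.map (algebraMap ℝ ℂ)).det = algebraMap ℝ ℂ B.det :=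
      ((algebraMap ℝ ℂ).map_det B).symm
    rw [this] at hB
    exact hdet ((algebraMap ℝ ℂ).injective (hB.trans (map_zero _).symm))

lemma exists_charRoots_eq_map {n : ℕ} (B : Matrix (Fin n) (Fin n) ℝ) :
    ∃ z : Fin n → ℂ, charRoots B = Finset.univ.val.map z := by
  have hcard : (charRoots B).card = n := by
    rw [charRoots, ← (IsAlgClosed.splits _).natDegree_eq_card_roots, natDegree_map,
      charpoly_natDegree_eq_dim, Fintype.card_fin]
  obtain ⟨l, hl⟩ := Quot.exists_rep (charRoots B)
  have hl' : (l : Multiset ℂ) = charRoots B := hl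
  have hlen : l.length = n := by rw [← hcard, ← hl', Multiset.coe_card]
  subst hlen
  refine ⟨l.get, ?_⟩
  rw [← hl', Fin.univ_val_map, List.ofFn_get]

lemma map_charpoly_eq_prod {n : ℕ} {B : Matrix (Fin n) (Fin n) ℝ} {z : Fin n → ℂ}
    (hz : charRoots B = Finset.univ.val.map z) :
    B.charpoly.map (algebraMap ℝ ℂ) = ∏ i, (X - C (z i)) := by
  rw [(IsAlgClosed.splits (B.charpoly.map (algebraMap ℝ ℂ))).eq_prod_roots_of_monic
    (B.charpoly_monic.map _)]
  change (Multiset.map _ (charRoots B)).prod = _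
  rw [hz, Multiset.map_map]
  rfl

lemma inertia_eq_of_sign_re_eq {n : ℕ} {B B' : Matrix (Fin n) (Fin n) ℝ} {z z' : Fin n → ℂ}
    (hz : charRoots B = Finset.univ.val.map z) (hz' : charRoots B' = Finset.univ.val.map z')
    (h : ∀ i, SignType.sign (z i).re = SignType.sign (z' i).re) : inertia B = inertia B' := by
  have hpos : ∀ i, 0 < (z i).re ↔ 0 < (z' i).re := fun i => by
    rw [← sign_eq_one_iff, h, sign_eq_one_iff]
  have hneg : ∀ i, (z i).re < 0 ↔ (z' i).re < 0 := fun i => by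
    rw [← sign_eq_neg_one_iff, h, sign_eq_neg_one_iff]
  have hzero : ∀ i, (z i).re = 0 ↔ (z' i).re = 0 := fun i => by
    rw [← sign_eq_zero_iff, h, sign_eq_zero_iff]
  simp only [inertia, hz, hz', Multiset.filter_map, Multiset.card_map, Function.comp_def,
    hpos, hneg, hzero]

lemma norm_le_of_mem_charRoots {n : ℕ} {B : Matrix (Fin n) (Fin n) ℝ} {z : ℂ}
    (hz : z ∈ charRoots B) : ‖z‖ ≤ 2 * ∑ i, ∑ j, |B i j| := by
  have hroot : (B.map (algebraMap ℝ ℂ)).charpoly.IsRoot z := by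
    rw [charpoly_map]; exact (mem_roots'.1 hz).2
  rw [← charpoly_toLin', ← Module.End.hasEigenvalue_iff_isRoot_charpoly] at hroot
  obtain ⟨k, hk⟩ := eigenvalue_mem_ball hroot
  simp only [map_apply, Metric.mem_closedBall, Complex.coe_algebraMap, Complex.norm_real,
    Real.norm_eq_abs, dist_eq_norm] at hk
  have hrow : ∑ j, |B k j| ≤ ∑ i, ∑ j, |B i j| :=
    Finset.single_le_sum (f := fun i => ∑ j, |B i j|)
      (fun i _ => Finset.sum_nonneg fun j _ => abs_nonneg _) (Finset.mem_univ k)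
  have hdiag : |B k k| ≤ ∑ j, |B k j| :=
    Finset.single_le_sum (f := fun j => |B k j|) (fun j _ => abs_nonneg _) (Finset.mem_univ k)
  have herase : ∑ j ∈ Finset.univ.erase k, |B k j| ≤ ∑ j, |B k j| :=
    Finset.sum_le_sum_of_subset_of_nonneg (Finset.erase_subset _ _) fun j _ _ => abs_nonneg _
  have hnorm := norm_le_norm_sub_add z ((B k k : ℝ) : ℂ)
  rw [Complex.norm_real, Real.norm_eq_abs] at hnorm
  linarith

open Filter Topology in
/-- The inertia is locally constant at matrices without eigenvalues on the imaginary axis. -/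
lemma eventually_inertia_eq {n : ℕ} {B₀ : Matrix (Fin n) (Fin n) ℝ}
    (h₀ : ∀ z ∈ charRoots B₀, z.re ≠ 0) : ∀ᶠ B in 𝓝 B₀, inertia B = inertia B₀ := by
  choose z hz using fun B : Matrix (Fin n) (Fin n) ℝ => exists_charRoots_eq_map B
  have hmem : ∀ B i, z B i ∈ charRoots B := fun B i => by
    rw [hz B]; exact Multiset.mem_map_of_mem _ (Finset.mem_univ_val i)
  refine Filter.mem_iff_ultrafilter.2 fun U hU => ?_
  have hcont : Continuous fun B : Matrix (Fin n) (Fin n) ℝ => 2 * ∑ i, ∑ j, |B i j| := by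
    fun_prop
  set M := 2 * ∑ i, ∑ j, |B₀ i j| + 1
  have hbound : ∀ᶠ B in U, z B ∈ Set.univ.pi fun _ : Fin n => Metric.closedBall (0 : ℂ) M := by
    have hlt := (hcont.tendsto B₀).eventually_lt_const (lt_add_one _)
    filter_upwards [hU hlt] with B hB i _
    rw [mem_closedBall_zero_iff]
    exact (norm_le_of_mem_charRoots (hmem B i)).trans (le_of_lt hB)
  obtain ⟨w, -, hw⟩ := (isCompact_univ_pi fun _ : Fin n =>
    isCompact_closedBall (0 : ℂ) M).ultrafilter_le_nhds (U.map z) (le_principal_iff.2 hbound)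
  have hw' : Tendsto z U (𝓝 w) := hw
  have hwi : ∀ i, Tendsto (fun B => z B i) U (𝓝 (w i)) := fun i =>
    tendsto_pi_nhds.1 hw' i
  have hprod : B₀.charpoly.map (algebraMap ℝ ℂ) = ∏ i, (X - C (w i)) := by
    refine Polynomial.funext fun x => ?_
    have h₁ : Tendsto (fun B : Matrix (Fin n) (Fin n) ℝ =>
        (B.charpoly.map (algebraMap ℝ ℂ)).eval x) U
        (𝓝 ((B₀.charpoly.map (algebraMap ℝ ℂ)).eval x)) := by
      have hc : Continuous fun B : Matrix (Fin n) (Fin n) ℝ =>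
          (B.charpoly.map (algebraMap ℝ ℂ)).eval x := by
        simp only [← charpoly_map, eval_charpoly]
        exact (continuous_const.sub
          (continuous_id.matrix_map Complex.continuous_ofReal)).matrix_det
      exact (hc.tendsto B₀).mono_left hU
    have h₂ : Tendsto (fun B : Matrix (Fin n) (Fin n) ℝ =>
        (B.charpoly.map (algebraMap ℝ ℂ)).eval x) U
        (𝓝 ((∏ i, (X - C (w i))).eval x)) := by
      simp only [map_charpoly_eq_prod (hz _), eval_prod, eval_sub, eval_X, eval_C]
      exact tendsto_finsetProd _ fun i _ => tendsto_const_nhds.sub (hwi i)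
    exact tendsto_nhds_unique h₁ h₂
  have hroots : charRoots B₀ = Finset.univ.val.map w := by
    rw [charRoots, hprod, ← roots_multiset_prod_X_sub_C (Finset.univ.val.map w),
      Multiset.map_map]
    rfl
  have hsign : ∀ᶠ B in U, ∀ i, SignType.sign (z B i).re = SignType.sign (w i).re := by
    refine eventually_all.2 fun i => ?_
    have hi : (w i).re ≠ 0 :=
      h₀ _ (by rw [hroots]; exact Multiset.mem_map_of_mem _ (Finset.mem_univ_val i))
    have hre := (Complex.continuous_re.tendsto (w i)).comp (hwi i)
    rcases lt_or_gt_of_ne hi with hi | hi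
    · filter_upwards [hre.eventually_lt_const hi] with B hB
      rw [sign_neg hi]; exact sign_neg hB
    · filter_upwards [hre.eventually_const_lt hi] with B hB
      rw [sign_pos hi]; exact sign_pos hB
  filter_upwards [hsign] with B hB using inertia_eq_of_sign_re_eq (hz B) hroots hB

lemma convex_setOf_qClass {n : ℕ} (P : Matrix (Fin n) (Fin n) SignType) :
    Convex ℝ {B | QClass P B} := by
  intro A hA B hB a b ha hb hab i j
  have hij : SignType.sign (B i j) = SignType.sign (A i j) := (hB i j).trans (hA i j).symm
  rw [← hA i j]
  change SignType.sign (a * A i j + b * B i j) = _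
  rcases lt_trichotomy (A i j) 0 with h | h | h
  · rw [sign_neg h, sign_eq_neg_one_iff] at *
    exact (convex_Iio (0 : ℝ)) h hij ha hb hab
  · rw [h, sign_zero, sign_eq_zero_iff] at hij
    simp [h, hij]
  · rw [sign_pos h, sign_eq_one_iff] at *
    exact (convex_Ioi (0 : ℝ)) h hij ha hb hab

/-- A sign nonsingular `n`-cycle sign pattern with `0`-diagonal (`n ≥ 3` odd, standard
labeling) requires a unique inertia. -/
theorem odd_cycle_sign_nonsingular_unique_inertia (n : ℕ) (hn : 3 ≤ n) (hodd : Odd n)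
    (P : Matrix (Fin n) (Fin n) SignType)
    (hcyc : ∀ i j : Fin n, P i j ≠ 0 ↔
      (((i : ℕ) + 1) % n = j ∨ ((j : ℕ) + 1) % n = i))
    (hns : ∀ B, QClass P B → B.det ≠ 0) :
    RequiresUniqueInertia P := by
  obtain ⟨m, rfl⟩ : ∃ m, n = m + 3 := ⟨n - 3, by omega⟩
  have hrot : ∀ i j : Fin (m + 3), finRotate (m + 3) i = j ↔ ((i : ℕ) + 1) % (m + 3) = j := by
    intro i j
    rw [finRotate_apply, Fin.ext_iff, Fin.val_add, Fin.val_one]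
  have hc₁ : ∀ i : Fin (m + 3), finRotate (m + 3) i ≠ i := fun i =>
    Equiv.Perm.mem_support.1 (by rw [support_finRotate]; exact Finset.mem_univ i)
  have hc₁' : ∀ i : Fin (m + 3), (finRotate (m + 3))⁻¹ i ≠ i := fun i h =>
    hc₁ i (Equiv.Perm.inv_eq_iff_eq.1 h).symm
  have hc : ∀ i j, ∃ k : ℕ, (finRotate (m + 3) ^ k) i = j := fun i j =>
    isCycle_finRotate.exists_pow_eq (hc₁ i) (hc₁ j)
  have hc' : ∀ i j, ∃ k : ℕ, ((finRotate (m + 3))⁻¹ ^ k) i = j := fun i j =>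
    isCycle_finRotate.inv.exists_pow_eq (hc₁' i) (hc₁' j)
  have hre : ∀ B, QClass P B → ∀ z ∈ charRoots B, z.re ≠ 0 := by
    intro B hB z hz
    have hsupp : ∀ i j, B i j ≠ 0 → finRotate (m + 3) i = j ∨ finRotate (m + 3) j = i := by
      intro i j hij
      rw [hrot, hrot, ← hcyc, ← hB i j]
      exact sign_ne_zero.2 hij
    refine re_ne_zero_of_det_scalar_add_sub (hns B hB) hodd (fun x => ?_) hz
    refine det_scalar_add_sub_det_scalar_sub (c := finRotate (m + 3)) (by simpa using hodd)
      hc hc' hc₁ (fun i => ?_) (fun i j hij => hsupp i j fun h => hij (by simp [h])) x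
    have hii : B i i = 0 := by
      by_contra h
      rcases hsupp i i h with h | h <;> exact hc₁ i h
    simp [hii]
  intro B₁ B₂ h₁ h₂
  refine (convex_setOf_qClass P).isPreconnected.constant (f := inertia) (fun B hB => ?_) h₁ h₂
  exact (continuousAt_const.congr
    ((eventually_inertia_eq (hre B hB)).mono fun _ h => h.symm)).continuousWithinAt
end

section
/- Let n ≥ 3 and let P be an n-cycle sign pattern with 0-diagonal in standard labeling, with edge signs e i = P i (i+1) · P (i+1) i (indices mod n) for i ∈ ℤ/n. If the number of indices i with e i = − is odd, then P does not require a unique inertia: there exist B₁, B₂ ∈ Q(P) with In(B₁) ≠ In(B₂). -/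
open Polynomial Matrix

/-- The product of a multiset of complex numbers stable under conjugation has the sign given by
the parity of the number of elements with negative real part. -/
theorem neg_one_pow_card_mul_prod_of_map_conj_eq (s : Multiset ℂ)
    (hs : s.map (starRingEnd ℂ) = s) :
    (-1) ^ (s.filter (fun z => z.re < 0)).card * s.prod = (((s.map (‖·‖)).prod : ℝ) : ℂ) := by
  set f : ℂ → ℂ := fun z => (if z.re < 0 then -1 else 1) * z with hf
  have key : ∀ t : Multiset ℂ,
      (-1) ^ (t.filter (fun z => z.re < 0)).card * t.prod = (t.map f).prod := by
    intro t
    induction t using Multiset.induction_on with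
    | empty => simp
    | cons a t ih =>
      rw [Multiset.map_cons, Multiset.prod_cons, Multiset.prod_cons, ← ih]
      by_cases h : a.re < 0
      · simp only [hf, h, Multiset.filter_cons_of_pos, Multiset.card_cons, if_true]
        ring
      · simp only [hf, h, not_false_eq_true, Multiset.filter_cons_of_neg, if_false]
        ring
  have hsplit : s = s.filter (fun z => z.im = 0) +
      (s.filter (fun z => 0 < z.im) + (s.filter (fun z => 0 < z.im)).map (starRingEnd ℂ)) := by
    have h₁ : (s.filter (fun z => 0 < z.im)).map (starRingEnd ℂ)
        = s.filter (fun z => z.im < 0) := by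
      conv_rhs => rw [← hs]
      rw [Multiset.filter_map]
      congr 1
      exact Multiset.filter_congr fun z _ => by simp
    rw [h₁]
    ext z
    simp only [Multiset.count_add, Multiset.count_filter]
    rcases lt_trichotomy z.im 0 with h | h | h
    · simp [h, h.ne, h.not_gt]
    · simp [h]
    · simp [h, h.ne', h.not_gt]
  have hreal : ∀ t : Multiset ℂ, (∀ z ∈ t, z.im = 0) →
      (t.map f).prod = (((t.map (‖·‖)).prod : ℝ) : ℂ) := by
    intro t ht
    induction t using Multiset.induction_on with
    | empty => simp
    | cons a t ih =>
      have ha : f a = (‖a‖ : ℂ) := by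
        obtain ⟨x, rfl⟩ : ∃ x : ℝ, a = x :=
          ⟨a.re, Complex.ext rfl (by simpa using ht a (by simp))⟩
        by_cases h : x < 0
        · simp [hf, h, abs_of_neg h]
        · simp [hf, h, abs_of_nonneg (not_lt.1 h)]
      simp [ha, ih fun z hz => ht z (by simp [hz])]
  have hpair : ∀ t : Multiset ℂ, ((t + t.map (starRingEnd ℂ)).map f).prod
      = ((((t + t.map (starRingEnd ℂ)).map (‖·‖)).prod : ℝ) : ℂ) := by
    intro t
    induction t using Multiset.induction_on with
    | empty => simp
    | cons a t ih =>
      have ha : f a * f (starRingEnd ℂ a) = (‖a‖ : ℂ) * ‖a‖ := by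
        rw [← sq, ← Complex.mul_conj']
        by_cases h : a.re < 0 <;> simp [hf, h]
      simp only [Multiset.map_add, Multiset.prod_add, Multiset.map_cons, Multiset.prod_cons,
        Complex.ofReal_mul, RCLike.norm_conj] at ih ⊢
      linear_combination ha * (t.map f).prod * ((t.map (starRingEnd ℂ)).map f).prod +
        (‖a‖ : ℂ) * ‖a‖ * ih
  rw [key, hsplit, Multiset.map_add, Multiset.prod_add, hpair,
    hreal _ fun z hz => (Multiset.mem_filter.1 hz).2, ← Complex.ofReal_mul,
    ← Multiset.prod_add, ← Multiset.map_add]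

theorem neg_one_pow_inertia_mul_det_nonneg {n : ℕ} (B : Matrix (Fin n) (Fin n) ℝ) :
    0 ≤ (-1) ^ (inertia B).2.1 * B.det := by
  have hconj : (charRoots B).map (starRingEnd ℂ) = charRoots B := by
    rw [charRoots, ← Polynomial.Splits.roots_map (IsAlgClosed.splits _), Polynomial.map_map]
    congr 2
    ext x
    simp
  have hdet : (B.det : ℂ) = (charRoots B).prod := by
    have h := Matrix.det_eq_prod_roots_charpoly (B.map (algebraMap ℝ ℂ))
    rw [Matrix.charpoly_map] at h
    rw [charRoots, ← h]
    exact (algebraMap ℝ ℂ).map_det B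
  have h := neg_one_pow_card_mul_prod_of_map_conj_eq _ hconj
  rw [← hdet] at h
  have h' : (-1) ^ (inertia B).2.1 * B.det = ((charRoots B).map (‖·‖)).prod := by
    exact_mod_cast h
  rw [h']
  refine Multiset.prod_nonneg fun x hx => ?_
  obtain ⟨z, -, rfl⟩ := Multiset.mem_map.1 hx
  exact norm_nonneg z

/-- Two permutations whose terms in the determinant expansion of a sign pattern have opposite
signs yield two matrices of the qualitative class with different inertias. -/
theorem exists_inertia_ne_of_sign_mul_prod_neg {n : ℕ} (P : Matrix (Fin n) (Fin n) SignType)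
    (σ τ : Equiv.Perm (Fin n)) (hsign : σ.sign = τ.sign)
    (hprod : ∏ i, (P i (σ i) * P i (τ i)) = -1) :
    ∃ B₁ B₂, QClass P B₁ ∧ QClass P B₂ ∧ inertia B₁ ≠ inertia B₂ := by
  let A (ρ : Equiv.Perm (Fin n)) (ε : ℝ) : Matrix (Fin n) (Fin n) ℝ :=
    Matrix.of fun i j => (P i j : ℝ) * ((if ρ i = j then 1 else 0) + ε)
  have hA : ∀ ρ ε, 0 < ε → QClass P (A ρ ε) := by
    intro ρ ε hε i j
    have hc : (0 : ℝ) < (if ρ i = j then 1 else 0) + ε := by split_ifs <;> positivity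
    simp only [A, Matrix.of_apply, sign_mul, sign_pos hc, mul_one]
    cases P i j <;> simp
  have hdet : ∀ ρ, (A ρ 0).det = (ρ.sign : ℝ) * ∏ i, (P i (ρ i) : ℝ) := by
    intro ρ
    have : A ρ 0 = Matrix.diagonal (fun i => (P i (ρ i) : ℝ)) * ρ.permMatrix ℝ := by
      ext i j
      rw [Matrix.diagonal_mul]
      by_cases h : ρ i = j
      · subst h; simp [A, Equiv.Perm.permMatrix, PEquiv.toMatrix_apply]
      · simp [A, Equiv.Perm.permMatrix, PEquiv.toMatrix_apply, h]
    rw [this, Matrix.det_mul, Matrix.det_diagonal, Matrix.det_permutation, mul_comm]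
  have hneg : (A σ 0).det * (A τ 0).det < 0 := by
    have h : ∏ i, ((P i (σ i) : ℝ) * (P i (τ i) : ℝ)) = -1 := by
      have := congrArg (SignType.castHom (α := ℝ)) hprod
      rw [map_prod] at this
      simpa using this
    rw [Finset.prod_mul_distrib] at h
    have hs : ((τ.sign : ℤ) : ℝ) * ((τ.sign : ℤ) : ℝ) = 1 := by
      rcases Int.units_eq_one_or τ.sign with h | h <;> simp [h]
    rw [hdet, hdet, hsign, mul_mul_mul_comm, hs, h]
    norm_num
  have hcont : Continuous fun ε => (A σ ε).det * (A τ ε).det := by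
    refine Continuous.mul (Continuous.matrix_det ?_) (Continuous.matrix_det ?_) <;>
    exact continuous_matrix fun i j => by simp only [A, Matrix.of_apply]; fun_prop
  obtain ⟨ε, hε, hlt⟩ : ∃ ε > 0, (A σ ε).det * (A τ ε).det < 0 := by
    have h₁ := (hcont.tendsto 0).eventually_lt_const hneg
    have h₂ := h₁.filter_mono (nhdsWithin_le_nhds (s := Set.Ioi 0))
    obtain ⟨ε, h, hε⟩ := (h₂.and self_mem_nhdsWithin).exists
    exact ⟨ε, hε, h⟩
  refine ⟨A σ ε, A τ ε, hA _ _ hε, hA _ _ hε, fun heq => ?_⟩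
  have h₁ := neg_one_pow_inertia_mul_det_nonneg (A σ ε)
  have h₂ := neg_one_pow_inertia_mul_det_nonneg (A τ ε)
  rw [heq] at h₁
  rcases neg_one_pow_eq_or ℝ (inertia (A τ ε)).2.1 with h | h <;> rw [h] at h₁ h₂ <;>
    nlinarith

/-- There are two permutations of the same sign that together use each of the two directed edges
leaving every vertex of the cycle exactly once. -/
theorem exists_perm_sign_eq_add_one_sub_one (n : ℕ) [NeZero n] :
    ∃ σ τ : Equiv.Perm (Fin n), σ.sign = τ.sign ∧
      ∀ i, (σ i = i + 1 ∧ τ i = i - 1) ∨ (σ i = i - 1 ∧ τ i = i + 1) := by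
  rcases Nat.even_or_odd n with hn | hn
  · have hadd : ∀ i : Fin n, Even (i + 1).val ↔ ¬ Even i.val := by
      intro i
      have h2 : 2 ∣ n := hn.two_dvd
      rw [Fin.val_add, Fin.val_one', Nat.even_iff, Nat.mod_mod_of_dvd _ h2, Nat.add_mod,
        Nat.mod_mod_of_dvd _ h2, Nat.even_iff]
      omega
    have hsub : ∀ i : Fin n, Even (i - 1).val ↔ ¬ Even i.val := by
      intro i
      have := hadd (i - 1)
      rw [sub_add_cancel] at this
      tauto
    have hinv : Function.Involutive
        (fun i : Fin n => if Even i.val then i + 1 else i - 1) := by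
      intro i
      by_cases h : Even i.val
      · simp [h, hadd]
      · simp [h, hsub]
    refine ⟨hinv.toPerm, Equiv.addRight 1 * hinv.toPerm * (Equiv.addRight 1)⁻¹, ?_, fun i => ?_⟩
    · rw [Equiv.Perm.sign_mul, Equiv.Perm.sign_mul, Equiv.Perm.sign_inv, mul_right_comm,
        Int.units_mul_self, one_mul]
    · by_cases h : Even i.val
      · simp [h, hsub, ← sub_eq_add_neg]
      · simp [h, hsub, ← sub_eq_add_neg]
  · exact ⟨Equiv.addRight 1, (Equiv.addRight 1)⁻¹, (Equiv.Perm.sign_inv _).symm, fun i => by simp [sub_eq_add_neg]⟩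

/-- An `n`-cycle sign pattern with `0`-diagonal (`n ≥ 3`, standard labeling) with an odd
number of negative edges does not require a unique inertia.  Here `e i` is the sign of the
edge between `i` and `i + 1` (indices mod `n`). -/
theorem cycle_odd_negative_edges_not_unique_inertia (n : ℕ) (hn : 3 ≤ n)
    (P : Matrix (Fin n) (Fin n) SignType)
    (hcyc : ∀ i j : Fin n, P i j ≠ 0 ↔
      (((i : ℕ) + 1) % n = j ∨ ((j : ℕ) + 1) % n = i))
    (e : ℕ → SignType)
    (he : ∀ i : ℕ, e i =
      P ⟨i % n, Nat.mod_lt _ (by omega)⟩ ⟨(i + 1) % n, Nat.mod_lt _ (by omega)⟩ *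
        P ⟨(i + 1) % n, Nat.mod_lt _ (by omega)⟩ ⟨i % n, Nat.mod_lt _ (by omega)⟩)
    (hodd : Odd (((Finset.range n).filter (fun i => e i = SignType.neg)).card)) :
    ∃ B₁ B₂, QClass P B₁ ∧ QClass P B₂ ∧ inertia B₁ ≠ inertia B₂ := by
  have : NeZero n := ⟨by omega⟩
  obtain ⟨σ, τ, hsign, hστ⟩ := exists_perm_sign_eq_add_one_sub_one n
  refine exists_inertia_ne_of_sign_mul_prod_neg P σ τ hsign ?_
  have hval : ∀ i : Fin n, (i + 1).val = (i.val + 1) % n := by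
    intro i
    rw [Fin.val_add, Fin.val_one', Nat.add_mod_mod]
  have hedge : ∀ i : Fin n, e i = P i (i + 1) * P (i + 1) i := by
    intro i
    have h₁ : (⟨(i : ℕ) % n, Nat.mod_lt _ (by omega)⟩ : Fin n) = i :=
      Fin.ext (Nat.mod_eq_of_lt i.isLt)
    have h₂ : (⟨((i : ℕ) + 1) % n, Nat.mod_lt _ (by omega)⟩ : Fin n) = i + 1 :=
      Fin.ext (hval i).symm
    rw [he, h₁, h₂]
  have hsgn : ∀ i ∈ Finset.range n, e i = if e i = SignType.neg then -1 else 1 := by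
    intro i hi
    have h := hedge ⟨i, Finset.mem_range.1 hi⟩
    have hne : e i ≠ 0 := by
      rw [h]
      exact mul_ne_zero ((hcyc _ _).2 (Or.inl (hval _).symm)) ((hcyc _ _).2 (Or.inr (hval _).symm))
    revert hne
    cases e i <;> decide
  calc ∏ i, (P i (σ i) * P i (τ i)) = ∏ i, (P i (i + 1) * P i (i - 1)) := by
        refine Finset.prod_congr rfl fun i _ => ?_
        rcases hστ i with ⟨h₁, h₂⟩ | ⟨h₁, h₂⟩ <;> rw [h₁, h₂]
        exact mul_comm _ _
    _ = ∏ i, (P i (i + 1) * P (i + 1) i) := by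
        rw [Finset.prod_mul_distrib, Finset.prod_mul_distrib,
          ← Equiv.prod_comp (Equiv.addRight 1) fun i => P i (i - 1)]
        simp
    _ = ∏ i ∈ Finset.range n, e i := by
        rw [Finset.prod_range]
        exact Finset.prod_congr rfl fun i _ => (hedge i).symm
    _ = -1 := by
        rw [Finset.prod_congr rfl hsgn, Finset.prod_ite, Finset.prod_const, Finset.prod_const_one,
          mul_one, hodd.neg_one_pow]
end

section
/- Let n ≥ 3 and let P be an n-cycle sign pattern with 0-diagonal in standard labeling, with edge signs e i = P i (i+1) · P (i+1) i (indices mod n) for i ∈ ℤ/n. If e i = − for every i ∈ ℤ/n (every edge of the cycle is negative), then P does not require a unique inertia: there exist B₁, B₂ ∈ Q(P) with In(B₁) ≠ In(B₂). -/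
open Polynomial Matrix

theorem Matrix.roots_charpoly_sq {ι : Type*} [Fintype ι] [DecidableEq ι] (A : Matrix ι ι ℂ) :
    (A ^ 2).charpoly.roots = A.charpoly.roots.map (· ^ 2) := by
  have hsplit := (IsAlgClosed.splits A.charpoly).eq_prod_roots_of_monic A.charpoly_monic
  have hcard : A.charpoly.roots.card = Fintype.card ι := by
    rw [← (IsAlgClosed.splits A.charpoly).natDegree_eq_card_roots, A.charpoly_natDegree_eq_dim]
  have heval (x : ℂ) : A.charpoly.eval x = (A.charpoly.roots.map (fun a => x - a)).prod := by
    conv_lhs => rw [hsplit]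
    simp [eval_multiset_prod, Multiset.map_map]
  have hprod (x : ℂ) (s : Multiset ℂ) :
      (s.map (fun a => x ^ 2 - a ^ 2)).prod =
        (s.map (fun a => x - a)).prod * ((-1) ^ s.card * (s.map (fun a => -x - a)).prod) := by
    induction s using Multiset.induction with
    | empty => simp
    | cons a s ih =>
      simp only [Multiset.map_cons, Multiset.prod_cons, Multiset.card_cons, pow_succ (-1 : ℂ)]
      linear_combination (x ^ 2 - a ^ 2) * ih
  have hsq : (A ^ 2).charpoly = ((A.charpoly.roots.map (· ^ 2)).map (fun a => X - C a)).prod := by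
    refine Polynomial.funext fun y => ?_
    obtain ⟨x, rfl⟩ := IsAlgClosed.exists_pow_nat_eq y (n := 2) (by norm_num)
    have hfactor : Matrix.scalar ι (x ^ 2) - A ^ 2 =
        (Matrix.scalar ι x - A) * -(Matrix.scalar ι (-x) - A) := by
      rw [map_neg, map_pow, neg_sub, sub_neg_eq_add, add_comm A, pow_two, pow_two]
      exact (Matrix.scalar_commute x (Commute.all x) A).mul_self_sub_mul_self_eq'
    rw [eval_charpoly, hfactor, Matrix.det_mul, Matrix.det_neg, ← eval_charpoly, ← eval_charpoly,
      heval, heval, ← hcard, ← hprod]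
    simp [eval_multiset_prod, Multiset.map_map]
  rw [hsq, roots_multiset_prod_X_sub_C]

theorem Multiset.prod_le_sum_pow_card (s : Multiset ℝ) (hs : ∀ x ∈ s, 0 ≤ x) :
    s.prod ≤ s.sum ^ s.card := by
  induction s using Multiset.induction with
  | empty => simp
  | cons a s ih =>
    have ha : 0 ≤ a := hs a (Multiset.mem_cons_self a s)
    have hs' : ∀ x ∈ s, 0 ≤ x := fun x hx => hs x (Multiset.mem_cons_of_mem hx)
    have hsum : 0 ≤ s.sum := Multiset.sum_nonneg hs'
    rw [Multiset.prod_cons, Multiset.sum_cons, Multiset.card_cons, pow_succ']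
    gcongr
    · exact Multiset.prod_nonneg hs'
    · linarith
    · exact (ih hs').trans (by gcongr; linarith)

theorem charRoots_eq_roots_charpoly_map {n : ℕ} (B : Matrix (Fin n) (Fin n) ℝ) :
    charRoots B = (B.map (algebraMap ℝ ℂ)).charpoly.roots := by
  rw [charRoots, Matrix.charpoly_map]

theorem card_charRoots {n : ℕ} (B : Matrix (Fin n) (Fin n) ℝ) : (charRoots B).card = n := by
  rw [charRoots_eq_roots_charpoly_map, ← (IsAlgClosed.splits _).natDegree_eq_card_roots,
    Matrix.charpoly_natDegree_eq_dim, Fintype.card_fin]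

theorem det_sq_le_of_charRoots_re_eq_zero {n : ℕ} (B : Matrix (Fin n) (Fin n) ℝ)
    (h : ∀ z ∈ charRoots B, z.re = 0) {c : ℝ} (hc : -(B ^ 2).trace ≤ c) :
    B.det ^ 2 ≤ c ^ n := by
  have hdet : ((charRoots B).map Complex.normSq).prod = B.det ^ 2 := by
    rw [← map_multiset_prod, charRoots_eq_roots_charpoly_map, ← Matrix.det_eq_prod_roots_charpoly,
      ← RingHom.mapMatrix_apply, ← RingHom.map_det]
    simp [pow_two]
  have htrace : ((charRoots B).map Complex.normSq).sum = -(B ^ 2).trace := by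
    apply Complex.ofReal_injective
    have hsum : (((B ^ 2).trace : ℝ) : ℂ) = ((charRoots B).map (· ^ 2)).sum := by
      rw [charRoots_eq_roots_charpoly_map, ← Matrix.roots_charpoly_sq,
        ← Matrix.trace_eq_sum_roots_charpoly, ← RingHom.mapMatrix_apply, ← map_pow]
      exact AddMonoidHom.map_trace (algebraMap ℝ ℂ).toAddMonoidHom (B ^ 2)
    rw [Complex.ofReal_neg, hsum, ← Complex.ofRealHom_eq_coe, map_multiset_sum, Multiset.map_map,
      ← Multiset.sum_map_neg]
    refine congrArg Multiset.sum (Multiset.map_congr rfl fun z hz => ?_)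
    apply Complex.ext <;> simp [Complex.normSq_apply, pow_two, h z hz]
  have hnonneg : ∀ x ∈ (charRoots B).map Complex.normSq, 0 ≤ x := by
    simp only [Multiset.mem_map]
    rintro _ ⟨z, -, rfl⟩
    exact Complex.normSq_nonneg z
  have hle := Multiset.prod_le_sum_pow_card _ hnonneg
  have hsum := Multiset.sum_nonneg hnonneg
  rw [hdet, htrace, Multiset.card_map, card_charRoots] at hle
  rw [htrace] at hsum
  exact hle.trans (pow_le_pow_left₀ hsum hc n)

open scoped ComplexOrder in
theorem charRoots_re_eq_zero_of_transpose_eq_neg {n : ℕ} (B : Matrix (Fin n) (Fin n) ℝ)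
    (hB : Bᵀ = -B) (z : ℂ) (hz : z ∈ charRoots B) : z.re = 0 := by
  set A : Matrix (Fin n) (Fin n) ℂ := B.map (algebraMap ℝ ℂ) with hA
  have hAH : Aᴴ = -A := by
    ext i j
    have hij : B j i = -B i j := congrFun (congrFun hB i) j
    simp [hA, hij]
  rw [charRoots_eq_roots_charpoly_map, mem_roots', IsRoot.def, eval_charpoly,
    ← Matrix.exists_mulVec_eq_zero_iff] at hz
  obtain ⟨-, v, hv, hzv⟩ := hz
  have hAv : A *ᵥ v = z • v := by
    rw [Matrix.sub_mulVec, sub_eq_zero] at hzv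
    rw [← hzv]
    ext i
    simp [Matrix.mulVec_diagonal]
  have h1 : star v ⬝ᵥ (A *ᵥ v) = z * (star v ⬝ᵥ v) := by
    rw [hAv, dotProduct_smul, smul_eq_mul]
  have h2 : star v ⬝ᵥ (A *ᵥ v) = -(star z * (star v ⬝ᵥ v)) := by
    have hvA : star v ᵥ* Aᴴ = star z • star v := by
      rw [← Matrix.star_mulVec, hAv, star_smul]
    rw [hAH, Matrix.vecMul_neg] at hvA
    rw [Matrix.dotProduct_mulVec, eq_neg_iff_add_eq_zero, ← smul_eq_mul, ← smul_dotProduct, ← hvA,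
      neg_dotProduct, add_neg_cancel]
  have hvv : star v ⬝ᵥ v ≠ 0 := dotProduct_star_self_eq_zero.not.mpr hv
  have hsum : z + star z = 0 := by
    refine (mul_eq_zero.mp ?_).resolve_right hvv
    linear_combination h2 - h1
  have hre := congrArg Complex.re hsum
  simp at hre
  linarith

theorem charRoots_re_eq_zero_of_inertia_eq {n : ℕ} {B₁ B₂ : Matrix (Fin n) (Fin n) ℝ}
    (h : inertia B₁ = inertia B₂) (h₁ : ∀ z ∈ charRoots B₁, z.re = 0) :
    ∀ z ∈ charRoots B₂, z.re = 0 := by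
  have h0 : (((charRoots B₂).filter (fun z => z.re = 0)).card) = (charRoots B₂).card := by
    have hzero := congrArg (fun p => p.2.2) h
    simp only [inertia] at hzero
    rw [← hzero, Multiset.filter_eq_self.mpr h₁, card_charRoots, card_charRoots]
  exact Multiset.filter_eq_self.mp
    (Multiset.eq_of_le_of_card_le (Multiset.filter_le _ _) h0.ge)

/-- The matrix with the entries of `P` as signs whose forward cycle entries have modulus `1` and
whose other entries are scaled by `s`. -/
def scaledCycle {n : ℕ} (P : Matrix (Fin n) (Fin n) SignType) (s : ℝ) :
    Matrix (Fin n) (Fin n) ℝ :=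
  fun i j => (if ((i : ℕ) + 1) % n = j then 1 else s) * ((P i j : SignType) : ℝ)

theorem continuous_det_scaledCycle {n : ℕ} (P : Matrix (Fin n) (Fin n) SignType) :
    Continuous fun s => (scaledCycle P s).det := by
  refine Continuous.matrix_det (continuous_pi fun i => continuous_pi fun j => ?_)
  unfold scaledCycle
  split_ifs <;> fun_prop

theorem sign_signType_cast (a : SignType) : SignType.sign (a : ℝ) = a := by
  cases a <;> simp

theorem qClass_scaledCycle {n : ℕ} (P : Matrix (Fin n) (Fin n) SignType) {s : ℝ} (hs : 0 < s) :
    QClass P (scaledCycle P s) := by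
  intro i j
  unfold scaledCycle
  split_ifs
  · rw [one_mul, sign_signType_cast]
  · rw [sign_mul, sign_pos hs, one_mul, sign_signType_cast]

theorem det_scaledCycle_zero_sq {n : ℕ} (P : Matrix (Fin n) (Fin n) SignType)
    (hP : ∀ i j : Fin n, ((i : ℕ) + 1) % n = j → P i j ≠ 0) :
    (scaledCycle P 0).det ^ 2 = 1 := by
  have hsq (a : SignType) (ha : a ≠ 0) : (a : ℝ) * (a : ℝ) = 1 := by
    cases a <;> simp at ha ⊢
  have hmul : scaledCycle P 0 * (scaledCycle P 0)ᵀ = 1 := by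
    ext i k
    have hn : 0 < n := i.pos
    rw [Matrix.mul_apply, Finset.sum_eq_single ⟨((i : ℕ) + 1) % n, Nat.mod_lt _ hn⟩]
    · by_cases hik : i = k
      · subst hik
        simp [scaledCycle, hsq _ (hP i ⟨((i : ℕ) + 1) % n, Nat.mod_lt _ hn⟩ rfl)]
      · have hne : ((k : ℕ) + 1) % n ≠ ((i : ℕ) + 1) % n := fun h => hik <| Fin.ext <|
          (Nat.ModEq.add_right_cancel' 1 h).symm.eq_of_lt_of_lt i.isLt k.isLt
        simp [scaledCycle, hne, hik]
    · intro j _ hj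
      have hne : ((i : ℕ) + 1) % n ≠ j := fun h => hj (Fin.ext h.symm)
      simp [scaledCycle, hne]
    · simp
  simpa [pow_two] using congrArg Matrix.det hmul

theorem add_one_mod_ne_of_add_one_mod_eq {n i j : ℕ} (hn : 3 ≤ n) (hi : i < n)
    (h : (i + 1) % n = j) : (j + 1) % n ≠ i := by
  intro h'
  rw [← h, Nat.mod_add_mod] at h'
  have hmod : i + 2 ≡ i + 0 [MOD n] := by simpa [Nat.ModEq, Nat.mod_eq_of_lt hi] using h'
  have hdvd := Nat.modEq_zero_iff_dvd.mp (Nat.ModEq.add_left_cancel' _ hmod)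
  exact absurd (Nat.le_of_dvd (by norm_num) hdvd) (by omega)

theorem neg_trace_scaledCycle_sq_le {n : ℕ} (hn : 3 ≤ n) (P : Matrix (Fin n) (Fin n) SignType)
    (hP : ∀ i j : Fin n, P i j ≠ 0 → ((i : ℕ) + 1) % n = j ∨ ((j : ℕ) + 1) % n = i)
    {s : ℝ} (hs : 0 < s) :
    -(scaledCycle P s ^ 2).trace ≤ n * n * s := by
  have hcast (a : SignType) : |(a : ℝ)| ≤ 1 := by
    cases a <;> simp
  have hterm (i j : Fin n) : -s ≤ scaledCycle P s i j * scaledCycle P s j i := by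
    by_cases hij : P i j = 0
    · simp [scaledCycle, hij, hs.le]
    · have hcoef : (if ((i : ℕ) + 1) % n = j then 1 else s) *
          (if ((j : ℕ) + 1) % n = i then 1 else s) = s := by
        rcases hP i j hij with h | h
        · simp [h, add_one_mod_ne_of_add_one_mod_eq hn i.isLt h]
        · simp [h, add_one_mod_ne_of_add_one_mod_eq hn j.isLt h]
      have hab : |((P i j * P j i : SignType) : ℝ)| ≤ 1 := hcast _
      have heq : scaledCycle P s i j * scaledCycle P s j i =
          s * ((P i j * P j i : SignType) : ℝ) := by
        rw [scaledCycle, scaledCycle, SignType.coe_mul]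
        linear_combination ((P i j : SignType) : ℝ) * ((P j i : SignType) : ℝ) * hcoef
      rw [heq]
      nlinarith [(abs_le.mp hab).1]
  have hsum : ∑ _i : Fin n, ∑ _j : Fin n, -s ≤ (scaledCycle P s ^ 2).trace := by
    simp only [Matrix.trace, Matrix.diag_apply, pow_two, Matrix.mul_apply]
    exact Finset.sum_le_sum fun i _ => Finset.sum_le_sum fun j _ => hterm i j
  simp at hsum
  linarith

/-- An `n`-cycle sign pattern with `0`-diagonal (`n ≥ 3`, standard labeling) in which every
edge is negative does not require a unique inertia.  Here `e i` is the sign of the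
edge between `i` and `i + 1` (indices mod `n`). -/
theorem cycle_all_negative_edges_not_unique_inertia (n : ℕ) (hn : 3 ≤ n)
    (P : Matrix (Fin n) (Fin n) SignType)
    (hcyc : ∀ i j : Fin n, P i j ≠ 0 ↔
      (((i : ℕ) + 1) % n = j ∨ ((j : ℕ) + 1) % n = i))
    (e : ℕ → SignType)
    (he : ∀ i : ℕ, e i =
      P ⟨i % n, Nat.mod_lt _ (by omega)⟩ ⟨(i + 1) % n, Nat.mod_lt _ (by omega)⟩ *
        P ⟨(i + 1) % n, Nat.mod_lt _ (by omega)⟩ ⟨i % n, Nat.mod_lt _ (by omega)⟩)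
    (hallneg : ∀ i : ℕ, e i = SignType.neg) :
    ∃ B₁ B₂, QClass P B₁ ∧ QClass P B₂ ∧ inertia B₁ ≠ inertia B₂ := by
  have hn0 : 0 < n := by omega
  have hskew_forward (i j : Fin n) (hij : ((i : ℕ) + 1) % n = j) : P j i = -P i j := by
    have hi := (he i).symm.trans (hallneg i)
    have h1 : (⟨(i : ℕ) % n, Nat.mod_lt _ hn0⟩ : Fin n) = i :=
      Fin.ext (Nat.mod_eq_of_lt i.isLt)
    have h2 : (⟨((i : ℕ) + 1) % n, Nat.mod_lt _ hn0⟩ : Fin n) = j := Fin.ext hij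
    rw [h1, h2] at hi
    generalize P i j = a at hi ⊢
    generalize P j i = b at hi ⊢
    revert a b
    decide
  have hskew (i j : Fin n) : P j i = -P i j := by
    by_cases hij : P i j = 0
    · have hji : P j i = 0 := by
        by_contra h
        exact (hcyc i j).mpr ((hcyc j i).mp h).symm hij
      rw [hij, hji]
      rfl
    · rcases (hcyc i j).mp hij with h | h
      · exact hskew_forward i j h
      · rw [hskew_forward j i h, neg_neg]
  have hB₁ : ∀ z ∈ charRoots (Matrix.of fun i j => ((P i j : SignType) : ℝ)), z.re = 0 := by
    refine charRoots_re_eq_zero_of_transpose_eq_neg _ ?_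
    ext i j
    simp [Matrix.transpose_apply, hskew i j]
  have hdet : ∀ᶠ s in nhdsWithin (0 : ℝ) (Set.Ioi 0), 1 / 2 < (scaledCycle P s).det ^ 2 := by
    have hc : Continuous fun s => (scaledCycle P s).det ^ 2 := (continuous_det_scaledCycle P).pow 2
    refine (hc.tendsto 0).eventually_const_lt ?_ |>.filter_mono nhdsWithin_le_nhds
    rw [det_scaledCycle_zero_sq P fun i j h => (hcyc i j).mpr (Or.inl h)]
    norm_num
  have hsmall : ∀ᶠ s : ℝ in nhdsWithin 0 (Set.Ioi 0), n * n * s < 1 / 2 := by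
    have hc : Continuous fun s : ℝ => n * n * s := by fun_prop
    exact (hc.tendsto 0).eventually_lt_const (by norm_num) |>.filter_mono nhdsWithin_le_nhds
  obtain ⟨s, ⟨hs_det, hs_small⟩, hs⟩ := ((hdet.and hsmall).and self_mem_nhdsWithin).exists
  refine ⟨Matrix.of fun i j => ((P i j : SignType) : ℝ), scaledCycle P s, ?_, qClass_scaledCycle P hs,
    fun hinertia => ?_⟩
  · exact fun i j => sign_signType_cast (P i j)
  · have hle := det_sq_le_of_charRoots_re_eq_zero _
      (charRoots_re_eq_zero_of_inertia_eq hinertia hB₁)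
      (neg_trace_scaledCycle_sq_le hn P (fun i j => (hcyc i j).mp) hs)
    have hpos : (0 : ℝ) ≤ n * n * s := mul_nonneg (by positivity) (le_of_lt hs)
    have hpow := pow_le_of_le_one hpos (by linarith) hn0.ne'
    linarith
end

section
/- Let P be an n×n combinatorially symmetric sign pattern with 0-diagonal whose underlying graph G is connected and has exactly n edges (so G is unicyclic: it contains exactly one cycle). Let c be a cycle in G of length k ≥ 3 with vertex set V(C), and assume that for every leaf u of G (a vertex of degree 1), the minimum over v ∈ V(C) of the graph distance between u and v in G is even. Then the maximum length of a composite cycle of P equals k plus the maximum length of a composite cycle of P whose support is disjoint from V(C) (the latter maximum being 0 if the only such composite cycle is the identity). -/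
open Polynomial Matrix

/-- The underlying (signed undirected) graph of a combinatorially symmetric sign pattern:
`i` is adjacent to `j` iff `i ≠ j` and the `(i,j)` entry is nonzero. -/
def patternGraph {n : ℕ} (P : Matrix (Fin n) (Fin n) SignType) : SimpleGraph (Fin n) :=
  SimpleGraph.fromRel (fun i j => P i j ≠ 0)

/-- `σ` is a composite cycle of the sign pattern `P`. -/
def IsCompositeCycle {n : ℕ} (P : Matrix (Fin n) (Fin n) SignType)
    (σ : Equiv.Perm (Fin n)) : Prop :=
  ∀ i ∈ σ.support, P i (σ i) ≠ 0

namespace SimpleGraph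

variable {V : Type*} {G : SimpleGraph V}

/-- The distance from a vertex to a set of vertices. -/
noncomputable def distToSet (G : SimpleGraph V) (s : Set V) (u : V) : ℕ :=
  sInf {d : ℕ | ∃ w ∈ s, G.dist u w = d}

lemma exists_dist_eq_distToSet {s : Set V} (hs : s.Nonempty) (u : V) :
    ∃ w ∈ s, G.dist u w = G.distToSet s u := by
  obtain ⟨w, hw⟩ := hs
  exact Nat.sInf_mem (s := {d : ℕ | ∃ w ∈ s, G.dist u w = d}) ⟨_, w, hw, rfl⟩

lemma distToSet_le_dist {s : Set V} {w : V} (hw : w ∈ s) (u : V) :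
    G.distToSet s u ≤ G.dist u w :=
  Nat.sInf_le ⟨w, hw, rfl⟩

lemma Connected.distToSet_eq_zero_iff (hG : G.Connected) {s : Set V} (hs : s.Nonempty) {u : V} :
    G.distToSet s u = 0 ↔ u ∈ s := by
  constructor
  · intro h
    obtain ⟨w, hw, hd⟩ := exists_dist_eq_distToSet (G := G) hs u
    rw [h, hG.dist_eq_zero_iff] at hd
    exact hd ▸ hw
  · intro h
    simpa using distToSet_le_dist (G := G) h u

lemma Connected.exists_adj_distToSet_add_one_eq (hG : G.Connected) {s : Set V} (hs : s.Nonempty)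
    {u : V} (hu : u ∉ s) : ∃ x, G.Adj u x ∧ G.distToSet s x + 1 = G.distToSet s u := by
  obtain ⟨w, hw, hd⟩ := exists_dist_eq_distToSet (G := G) hs u
  obtain ⟨q, hq⟩ := hG.exists_walk_length_eq_dist u w
  cases q with
  | nil => exact absurd hw hu
  | @cons _ x _ h q =>
    refine ⟨x, h, ?_⟩
    obtain ⟨w', hw', hd'⟩ := exists_dist_eq_distToSet (G := G) hs x
    have h1 := distToSet_le_dist (G := G) hw x
    have h2 := distToSet_le_dist (G := G) hw' u
    have h3 := hG.dist_triangle (u := u) (v := x) (w := w')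
    have h4 := dist_le q
    have h5 : G.dist u x = 1 := dist_eq_one_iff_adj.2 h
    simp only [Walk.length_cons] at hq
    omega

lemma Walk.IsCycle.mem_support_tail_iff {v : V} {c : G.Walk v v} (hc : c.IsCycle) {x : V} :
    x ∈ c.support.tail ↔ x ∈ c.support := by
  refine ⟨List.mem_of_mem_tail, fun h => ?_⟩
  rw [← c.cons_tail_support, List.mem_cons] at h
  rcases h with rfl | h
  · exact c.end_mem_tail_support hc.not_nil
  · exact h

lemma Walk.IsCycle.card_toFinset_support_tail [DecidableEq V] {v : V} {c : G.Walk v v}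
    (hc : c.IsCycle) : c.support.tail.toFinset.card = c.length := by
  rw [List.toFinset_card_of_nodup hc.support_nodup]
  simp

/-- In a graph with as many edges as vertices, each edge has both ends on a given cycle or joins
a vertex off the cycle to its chosen neighbour closer to the cycle. -/
lemma Walk.IsCycle.mem_support_or_eq_parent_of_adj [Fintype V] {v : V} {c : G.Walk v v}
    (hc : c.IsCycle) (hedges : G.edgeSet.ncard = Fintype.card V)
    {p : V → V} {d : V → ℕ}
    (hp : ∀ u ∉ c.support, G.Adj u (p u) ∧ d (p u) + 1 = d u) {a b : V} (hab : G.Adj a b) :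
    (a ∈ c.support ∧ b ∈ c.support) ∨ (a ∉ c.support ∧ b = p a) ∨
      (b ∉ c.support ∧ a = p b) := by
  classical
  set off : Finset V := Finset.univ \ c.support.tail.toFinset with hoff
  have mem_off {x : V} : x ∈ off ↔ x ∉ c.support := by
    simp [hoff, hc.mem_support_tail_iff]
  have hinj : Set.InjOn (fun x => s(x, p x)) off := by
    intro x hx y hy hxy
    have hx' := hp x (mem_off.1 hx)
    have hy' := hp y (mem_off.1 hy)
    simp only [Sym2.eq_iff] at hxy
    rcases hxy with h | ⟨h1, h2⟩
    · exact h.1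
    · rw [h2] at hx'
      rw [← h1] at hy'
      omega
  have hdisj : Disjoint c.edges.toFinset (off.image fun x => s(x, p x)) := by
    rw [Finset.disjoint_left]
    intro e he he'
    obtain ⟨x, hx, rfl⟩ := Finset.mem_image.1 he'
    exact mem_off.1 hx (c.fst_mem_support_of_mem_edges (List.mem_toFinset.1 he))
  have hcard : (c.edges.toFinset ∪ off.image fun x => s(x, p x)).card = G.edgeFinset.card := by
    rw [Finset.card_union_of_disjoint hdisj, Finset.card_image_of_injOn hinj,
      List.toFinset_card_of_nodup hc.edges_nodup, Walk.length_edges, hoff,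
      Finset.card_sdiff_of_subset (Finset.subset_univ _), hc.card_toFinset_support_tail,
      Finset.card_univ, ← coe_edgeFinset, Set.ncard_coe_finset] at *
    have := Finset.card_le_univ c.support.tail.toFinset
    rw [hc.card_toFinset_support_tail] at this
    omega
  have hsub : (c.edges.toFinset ∪ off.image fun x => s(x, p x)) ⊆ G.edgeFinset := by
    intro e he
    rw [mem_edgeFinset]
    rcases Finset.mem_union.1 he with he | he
    · exact c.edges_subset_edgeSet (List.mem_toFinset.1 he)
    · obtain ⟨x, hx, rfl⟩ := Finset.mem_image.1 he
      exact (hp x (mem_off.1 hx)).1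
  have hmem : s(a, b) ∈ c.edges.toFinset ∪ off.image fun x => s(x, p x) := by
    rw [Finset.eq_of_subset_of_card_le hsub hcard.ge, mem_edgeFinset]
    exact hab
  rcases Finset.mem_union.1 hmem with h | h
  · have h := List.mem_toFinset.1 h
    exact Or.inl ⟨c.fst_mem_support_of_mem_edges h, c.snd_mem_support_of_mem_edges h⟩
  · obtain ⟨x, hx, hxe⟩ := Finset.mem_image.1 h
    rw [mem_off] at hx
    rcases Sym2.eq_iff.1 hxe with ⟨rfl, rfl⟩ | ⟨rfl, rfl⟩
    · exact Or.inr (Or.inl ⟨hx, rfl⟩)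
    · exact Or.inr (Or.inr ⟨hx, rfl⟩)

/-- A cycle gives a permutation of its vertices along edges of the graph. -/
lemma Walk.IsCycle.exists_perm [Fintype V] [DecidableEq V] {v : V} {c : G.Walk v v}
    (hc : c.IsCycle) :
    ∃ ρ : Equiv.Perm V, (∀ i ∈ ρ.support, G.Adj i (ρ i)) ∧
      ρ.support = c.support.tail.toFinset := by
  have hlen : c.support.tail.length = c.length := by simp
  have h3 := hc.three_le_length
  have hsupp : c.support.tail.formPerm.support = c.support.tail.toFinset := by
    refine List.support_formPerm_of_nodup _ hc.support_nodup fun x hx => ?_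
    rw [hx] at hlen
    simp at hlen
    omega
  have hget (i : ℕ) (hi : i < c.support.tail.length) :
      c.support.tail[i] = c.getVert (i + 1) := by
    rw [List.getElem_tail, support_getElem_eq_getVert]
  refine ⟨c.support.tail.formPerm, fun x hx => ?_, hsupp⟩
  rw [hsupp, List.mem_toFinset] at hx
  obtain ⟨i, hi, rfl⟩ := List.getElem_of_mem hx
  rw [List.formPerm_apply_getElem _ hc.support_nodup, hget, hget]
  rcases Nat.lt_or_ge (i + 1) c.length with h | h
  · rw [hlen, Nat.mod_eq_of_lt h]
    exact c.adj_getVert_succ h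
  · have : i + 1 = c.length := by omega
    rw [hlen, this, Nat.mod_self, getVert_length]
    simpa using c.adj_getVert_succ (i := 0) (by omega)

end SimpleGraph

/-- An injective choice of partners, inverted by `p`, gives an involution swapping partners. -/
lemma exists_perm_swap_of_leftInvOn {V : Type*} [Fintype V] [DecidableEq V] (O : Finset V)
    {f p : V → V} (hfO : ∀ x ∈ O, f x ∉ O) (hpf : ∀ x ∈ O, p (f x) = x) :
    ∃ τ : Equiv.Perm V, (∀ x ∈ τ.support, (x ∈ O ∧ τ x = f x) ∨ (τ x ∈ O ∧ x = f (τ x))) ∧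
      2 * O.card ≤ τ.support.card := by
  classical
  set g : V → V := fun x => if x ∈ O then f x else if p x ∈ O ∧ f (p x) = x then p x else x
    with hg
  have hgO {x : V} (hx : x ∈ O) : g x = f x := by simp [hg, hx]
  have hgf {x : V} (hx : x ∈ O) : g (f x) = x := by simp [hg, hx, hfO x hx, hpf x hx]
  have hcases (x : V) : x ∈ O ∨ (∃ y ∈ O, x = f y) ∨ g x = x := by
    by_cases h1 : x ∈ O
    · exact Or.inl h1
    by_cases h2 : p x ∈ O ∧ f (p x) = x
    · exact Or.inr (Or.inl ⟨p x, h2.1, h2.2.symm⟩)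
    · exact Or.inr (Or.inr (by simp only [hg, if_neg h1, if_neg h2]))
  have hinv : Function.Involutive g := by
    intro x
    rcases hcases x with h | ⟨y, hy, rfl⟩ | h
    · rw [hgO h, hgf h]
    · rw [hgf hy, hgO hy]
    · rw [h, h]
  have hne {x : V} (hx : x ∈ O) : f x ≠ x := fun h => hfO x hx (h.symm ▸ hx)
  refine ⟨hinv.toPerm, fun x hx => ?_, ?_⟩
  · rw [Equiv.Perm.mem_support, Function.Involutive.coe_toPerm] at hx
    rw [Function.Involutive.coe_toPerm]
    rcases hcases x with h | ⟨y, hy, rfl⟩ | h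
    · exact Or.inl ⟨h, hgO h⟩
    · rw [hgf hy]
      exact Or.inr ⟨hy, rfl⟩
    · exact absurd h hx
  · have hdisj : Disjoint O (O.image f) := by
      rw [Finset.disjoint_left]
      intro x hx hx'
      obtain ⟨y, hy, rfl⟩ := Finset.mem_image.1 hx'
      exact hfO y hy hx
    have hinj : Set.InjOn f O := fun x hx y hy h => by rw [← hpf x hx, h, hpf y hy]
    rw [two_mul]
    nth_rewrite 2 [← Finset.card_image_of_injOn hinj]
    rw [← Finset.card_union_of_disjoint hdisj]
    refine Finset.card_le_card fun x hx => ?_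
    rw [Equiv.Perm.mem_support, Function.Involutive.coe_toPerm]
    rcases Finset.mem_union.1 hx with h | h
    · rw [hgO h]
      exact hne h
    · obtain ⟨y, hy, rfl⟩ := Finset.mem_image.1 h
      rw [hgf hy]
      exact (hne hy).symm

/-- If a permutation sends every moved point outside `C ∪ O` into `O`, then its support is small. -/
lemma card_support_le_card_add_two_mul {V : Type*} [Fintype V] [DecidableEq V] (C O : Finset V)
    {σ : Equiv.Perm V} (h : ∀ x ∈ σ.support, x ∉ C → x ∉ O → σ x ∈ O) :
    σ.support.card ≤ C.card + 2 * O.card := by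
  have hE : ((σ.support \ C) \ O).card ≤ O.card :=
    Finset.card_le_card_of_injOn σ (fun x hx => by
      simp only [Finset.coe_sdiff, Set.mem_sdiff, Finset.mem_coe] at hx
      exact h x hx.1.1 hx.1.2 hx.2) σ.injective.injOn
  have h1 := Finset.card_le_card_sdiff_add_card (s := σ.support) (t := C)
  have h2 := Finset.card_le_card_sdiff_add_card (s := σ.support \ C) (t := O)
  omega

lemma adj_patternGraph_iff {n : ℕ} {P : Matrix (Fin n) (Fin n) SignType}
    (hsym : ∀ i j, P i j ≠ 0 ↔ P j i ≠ 0) {i j : Fin n} :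
    (patternGraph P).Adj i j ↔ i ≠ j ∧ P i j ≠ 0 := by
  simp [patternGraph, SimpleGraph.fromRel_adj, ← hsym i j]

lemma isCompositeCycle_iff_forall_adj {n : ℕ} {P : Matrix (Fin n) (Fin n) SignType}
    (hsym : ∀ i j, P i j ≠ 0 ↔ P j i ≠ 0) {σ : Equiv.Perm (Fin n)} :
    IsCompositeCycle P σ ↔ ∀ i ∈ σ.support, (patternGraph P).Adj i (σ i) := by
  refine forall₂_congr fun i hi => ?_
  rw [adj_patternGraph_iff hsym]
  exact (and_iff_right (Equiv.Perm.mem_support.1 hi).symm).symm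

lemma IsCompositeCycle.mul {n : ℕ} {P : Matrix (Fin n) (Fin n) SignType}
    {ρ σ : Equiv.Perm (Fin n)} (hρ : IsCompositeCycle P ρ) (hσ : IsCompositeCycle P σ)
    (hd : ρ.Disjoint σ) : IsCompositeCycle P (ρ * σ) := by
  intro i hi
  rw [Equiv.Perm.mem_support] at hi
  rcases hd i with h | h
  · rw [hd.commute.eq, Equiv.Perm.mul_apply, h] at hi ⊢
    exact hσ i (Equiv.Perm.mem_support.2 hi)
  · rw [Equiv.Perm.mul_apply, h] at hi ⊢
    exact hρ i (Equiv.Perm.mem_support.2 hi)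

/-- Let `P` be a combinatorially symmetric sign pattern with `0`-diagonal whose underlying
graph `G` is connected with exactly `n` edges (unicyclic).  If `c` is a cycle in `G` of
length `k` and every leaf of `G` is at even distance from the cycle, then the maximum length
of a composite cycle of `P` equals `k` plus the maximum length of a composite cycle of `P`
avoiding the vertices of `c`. -/
theorem unicyclic_even_leaf_distance_max_composite_cycle (n : ℕ)
    (P : Matrix (Fin n) (Fin n) SignType)
    (hdiag : ∀ i, P i i = 0)
    (hsym : ∀ i j, P i j ≠ 0 ↔ P j i ≠ 0)
    (hconn : (patternGraph P).Connected)
    (hedges : (patternGraph P).edgeSet.ncard = n)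
    (v : Fin n) (c : (patternGraph P).Walk v v) (hc : c.IsCycle)
    (k : ℕ) (hk : c.length = k) (hk3 : 3 ≤ k)
    (hleaf : ∀ u : Fin n, ((patternGraph P).neighborSet u).ncard = 1 →
      Even (sInf {d : ℕ | ∃ w ∈ c.support, (patternGraph P).dist u w = d})) :
    sSup {l : ℕ | ∃ σ : Equiv.Perm (Fin n), IsCompositeCycle P σ ∧ σ.support.card = l}
      = k + sSup {l : ℕ | ∃ σ : Equiv.Perm (Fin n), IsCompositeCycle P σ ∧
          (∀ i ∈ σ.support, i ∉ c.support) ∧ σ.support.card = l} := by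
  classical
  have hs : {w | w ∈ c.support}.Nonempty := ⟨v, c.start_mem_support⟩
  set d : Fin n → ℕ := (patternGraph P).distToSet {w | w ∈ c.support}
  have hd0 {u : Fin n} : d u = 0 ↔ u ∈ c.support := hconn.distToSet_eq_zero_iff hs
  have hpar (u : Fin n) : ∃ x, u ∉ c.support → (patternGraph P).Adj u x ∧ d x + 1 = d u := by
    by_cases hu : u ∈ c.support
    · exact ⟨u, fun h => absurd hu h⟩
    · obtain ⟨x, hx⟩ := hconn.exists_adj_distToSet_add_one_eq hs (u := u) hu
      exact ⟨x, fun _ => hx⟩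
  choose p hp using hpar
  have hadj {a b : Fin n} (hab : (patternGraph P).Adj a b) :=
    hc.mem_support_or_eq_parent_of_adj (by rw [hedges, Fintype.card_fin]) hp hab
  set O : Finset (Fin n) := {x | Odd (d x)} with hO
  have memO {x : Fin n} : x ∈ O ↔ Odd (d x) := by simp [hO]
  have odd_off {x : Fin n} (hx : Odd (d x)) : x ∉ c.support := fun h => by
    rw [hd0.2 h] at hx
    exact absurd hx (by decide)
  have hchild (x : Fin n) : ∃ y, x ∈ O → y ∉ c.support ∧ p y = x := by
    by_cases hx : x ∈ O
    swap
    · exact ⟨x, fun h => absurd h hx⟩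
    rw [memO] at hx
    have hxp := hp x (odd_off hx)
    obtain ⟨y, hy, hyp⟩ : ∃ y, (patternGraph P).Adj x y ∧ y ≠ p x := by
      by_contra! hall
      refine Nat.not_even_iff_odd.2 hx (hleaf x ?_)
      rw [Set.ncard_eq_one]
      refine ⟨p x, Set.eq_singleton_iff_unique_mem.2 ⟨hxp.1, fun y hy => hall y hy⟩⟩
    rcases hadj hy with h | h | h
    · exact absurd h.1 (odd_off hx)
    · exact absurd h.2 hyp
    · exact ⟨y, fun _ => ⟨h.1, h.2.symm⟩⟩
  choose f hf using hchild
  have hfd {x : Fin n} (hx : x ∈ O) : (patternGraph P).Adj x (f x) ∧ d (f x) = d x + 1 := by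
    have h := hp (f x) (hf x hx).1
    rw [(hf x hx).2] at h
    exact ⟨h.1.symm, h.2.symm⟩
  have hfO (x : Fin n) (hx : x ∈ O) : f x ∉ O := by
    rw [memO, (hfd hx).2, Nat.not_odd_iff_even]
    exact (memO.1 hx).add_one
  obtain ⟨τ, hτ, hτcard⟩ := exists_perm_swap_of_leftInvOn O hfO fun x hx => (hf x hx).2
  obtain ⟨ρ, hρ, hρsupp⟩ := hc.exists_perm
  have hρcard : ρ.support.card = k := by
    rw [hρsupp, hc.card_toFinset_support_tail, hk]
  set A := {l : ℕ | ∃ σ : Equiv.Perm (Fin n), IsCompositeCycle P σ ∧ σ.support.card = l}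
  set B := {l : ℕ | ∃ σ : Equiv.Perm (Fin n), IsCompositeCycle P σ ∧
    (∀ i ∈ σ.support, i ∉ c.support) ∧ σ.support.card = l}
  have hA : BddAbove A := ⟨n, by
    rintro _ ⟨σ, -, rfl⟩
    simpa using Finset.card_le_univ σ.support⟩
  have hB : BddAbove B := hA.mono <| by
    rintro _ ⟨σ, h1, -, rfl⟩
    exact ⟨σ, h1, rfl⟩
  have hτB : τ.support.card ∈ B := by
    refine ⟨τ, (isCompositeCycle_iff_forall_adj hsym).2 fun x hx => ?_, fun x hx => ?_, rfl⟩
    · rcases hτ x hx with ⟨hxO, h⟩ | ⟨hxO, h⟩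
      · rw [h]
        exact (hfd hxO).1
      · have := (hfd hxO).1.symm
        rwa [← h] at this
    · rcases hτ x hx with ⟨hxO, -⟩ | ⟨hxO, h⟩
      · exact odd_off (memO.1 hxO)
      · rw [h]
        exact (hf _ hxO).1
  apply le_antisymm
  · refine csSup_le ⟨_, _, (isCompositeCycle_iff_forall_adj hsym).2 hρ, rfl⟩ ?_
    rintro _ ⟨σ, hσ, rfl⟩
    rw [isCompositeCycle_iff_forall_adj hsym] at hσ
    have hle : σ.support.card ≤ ρ.support.card + 2 * O.card := by
      refine card_support_le_card_add_two_mul _ _ fun x hx hxC hxO => ?_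
      rw [hρsupp, List.mem_toFinset, hc.mem_support_tail_iff] at hxC
      rw [memO, Nat.not_odd_iff_even] at hxO
      rw [memO]
      rcases hadj (hσ x hx) with h | h | h
      · exact absurd h.1 hxC
      · have := (hp x hxC).2
        rw [← h.2] at this
        rw [← this] at hxO
        exact Nat.not_even_iff_odd.1 (Nat.even_add_one.1 hxO)
      · have := (hp _ h.1).2
        rw [← h.2] at this
        rw [← this]
        exact hxO.add_one
    have := le_csSup hB hτB
    omega
  · obtain ⟨σ, hσ, hσc, hσcard⟩ := Nat.sSup_mem (Set.nonempty_of_mem hτB) hB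
    have hdisj : ρ.Disjoint σ := by
      rw [Equiv.Perm.disjoint_iff_disjoint_support, hρsupp, Finset.disjoint_right]
      intro x hx
      rw [List.mem_toFinset, hc.mem_support_tail_iff]
      exact hσc x hx
    rw [← hσcard, ← hρcard, ← hdisj.card_support_mul]
    exact le_csSup hA ⟨_, ((isCompositeCycle_iff_forall_adj hsym).2 hρ).mul hσ hdisj, rfl⟩
end

section
/- Let P be an n×n combinatorially symmetric sign pattern with 0-diagonal whose underlying graph G is connected and has exactly n edges (so G is unicyclic: it contains exactly one cycle). Let c be a cycle in G with vertex set V(C), and assume that for every leaf u of G (a vertex of degree 1), the minimum over v ∈ V(C) of the graph distance between u and v in G is even. If the number of edges {u,v} of the cycle c whose edge sign is negative (i.e., P u v · P v u = − in SignType) is odd, then P does not require a unique inertia: there exist B₁, B₂ ∈ Q(P) with In(B₁) ≠ In(B₂). -/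
open Polynomial Matrix

/-- The sign of the (undirected) edge `{u, v}` of a combinatorially symmetric sign pattern:
`P u v * P v u`. -/
def edgeSign {n : ℕ} (P : Matrix (Fin n) (Fin n) SignType) : Sym2 (Fin n) → SignType :=
  Sym2.lift ⟨fun u v => P u v * P v u, fun u v => mul_comm (P u v) (P v u)⟩

/-- The number of complex roots with positive real part, counted with multiplicity. -/
noncomputable def posRootCount (q : ℝ[X]) : ℕ :=
  (((q.map (algebraMap ℝ ℂ)).roots).filter (fun z => 0 < z.re)).card

lemma posRootCount_mul {p q : ℝ[X]} (hp : p ≠ 0) (hq : q ≠ 0) :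
    posRootCount (p * q) = posRootCount p + posRootCount q := by
  unfold posRootCount
  rw [Polynomial.map_mul, roots_mul, Multiset.filter_add, Multiset.card_add]
  rw [← Polynomial.map_mul]
  exact (Polynomial.map_ne_zero_iff (algebraMap ℝ ℂ).injective).2 (mul_ne_zero hp hq)

lemma posRootCount_X_pow (k : ℕ) : posRootCount (X ^ k) = 0 := by
  simp [posRootCount, Multiset.filter_nsmul]

lemma posRootCount_X_sub_C (r : ℝ) :
    posRootCount (X - C r) = if 0 < r then 1 else 0 := by
  have h : ((X - C r : ℝ[X]).map (algebraMap ℝ ℂ)) = X - C (r : ℂ) := by simp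
  rw [posRootCount, h, roots_X_sub_C, Multiset.filter_singleton]
  split_ifs <;> simp_all

lemma posRootCount_quadratic (z : ℂ) :
    posRootCount (X ^ 2 - C (2 * z.re) * X + C (‖z‖ ^ 2)) = if 0 < z.re then 2 else 0 := by
  have h : ((X ^ 2 - C (2 * z.re) * X + C (‖z‖ ^ 2) : ℝ[X]).map (algebraMap ℝ ℂ)) =
      (X - C z) * (X - C (starRingEnd ℂ z)) := by
    have h1 : ((2 * z.re : ℝ) : ℂ) = z + starRingEnd ℂ z := (Complex.add_conj z).symm
    have h2 : ((‖z‖ ^ 2 : ℝ) : ℂ) = z * starRingEnd ℂ z := by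
      rw [Complex.mul_conj, Complex.normSq_eq_norm_sq]
    simp only [Polynomial.map_add, Polynomial.map_sub, Polynomial.map_pow, Polynomial.map_mul,
      map_X, map_C, Complex.coe_algebraMap]
    rw [h1, h2, C_add, C_mul]
    ring
  rw [posRootCount, h, roots_mul (mul_ne_zero (X_sub_C_ne_zero _) (X_sub_C_ne_zero _)),
    roots_X_sub_C, roots_X_sub_C, Multiset.filter_add, Multiset.filter_singleton,
    Multiset.filter_singleton, Complex.conj_re]
  split_ifs <;> simp

lemma neg_one_pow_posRootCount_mul_eval_zero_pos (q : ℝ[X]) (hq : q.Monic) (h0 : q.eval 0 ≠ 0) :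
    0 < (-1) ^ posRootCount q * q.eval 0 := by
  induction hd : q.natDegree using Nat.strong_induction_on generalizing q with
  | _ d ih =>
  rcases Nat.eq_zero_or_pos d with rfl | hpos
  · rw [hq.natDegree_eq_zero.1 hd]
    simp [posRootCount]
  obtain ⟨z, hz⟩ := IsAlgClosed.exists_aeval_eq_zero ℂ q
    (by rw [Polynomial.degree_eq_natDegree hq.ne_zero, hd]; exact_mod_cast hpos.ne')
  by_cases him : z.im = 0
  · have hdvd : X - C z.re ∣ q := by
      rw [dvd_iff_isRoot]
      have hzr : z = algebraMap ℝ ℂ z.re := by apply Complex.ext <;> simp [him]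
      rw [hzr, aeval_algebraMap_apply] at hz
      simpa using hz
    obtain ⟨p, rfl⟩ := hdvd
    have hp : p.Monic := (monic_X_sub_C _).of_mul_monic_left hq
    rw [eval_mul] at h0 ⊢
    have hlt : p.natDegree < d := by
      rw [← hd, (monic_X_sub_C _).natDegree_mul hp, natDegree_X_sub_C]; omega
    have := ih _ hlt p hp (right_ne_zero_of_mul h0) rfl
    rw [posRootCount_mul (X_sub_C_ne_zero _) hp.ne_zero, posRootCount_X_sub_C, pow_add]
    have hr : z.re ≠ 0 := by rintro h; simp [h] at h0
    simp only [eval_sub, eval_X, eval_C]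
    split_ifs with h
    · have := mul_pos h this
      linarith
    · have := mul_pos (lt_of_le_of_ne (not_lt.1 h) hr |> neg_pos.2) this
      linarith
  · obtain ⟨p, rfl⟩ := quadratic_dvd_of_aeval_eq_zero_im_ne_zero q hz him
    have hdeg : (X ^ 2 - C (2 * z.re) * X + C (‖z‖ ^ 2) : ℝ[X]).natDegree = 2 := by compute_degree!
    have hquad : (X ^ 2 - C (2 * z.re) * X + C (‖z‖ ^ 2) : ℝ[X]).Monic := by monicity!
    have hp : p.Monic := hquad.of_mul_monic_left hq
    rw [eval_mul] at h0 ⊢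
    have hlt : p.natDegree < d := by
      rw [← hd, hquad.natDegree_mul hp, hdeg]; omega
    have := ih _ hlt p hp (right_ne_zero_of_mul h0) rfl
    rw [posRootCount_mul hquad.ne_zero hp.ne_zero, posRootCount_quadratic, pow_add]
    have hz0 : 0 < ‖z‖ ^ 2 := by
      have : z ≠ 0 := by rintro rfl; simp at him
      positivity
    have h1 := mul_pos hz0 this
    have h2 : (-1 : ℝ) ^ (if 0 < z.re then 2 else 0) = 1 := by split_ifs <;> norm_num
    rw [h2]
    simp only [eval_add, eval_sub, eval_mul, eval_pow, eval_X, eval_C]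
    linarith

lemma Matrix.det_one_add_eq_one {ι R : Type*} [Fintype ι] [DecidableEq ι] [CommRing R]
    {A D : Matrix ι ι R} (h₁ : A * D = A) (h₂ : D * A = 0) : (1 + A).det = 1 := by
  rw [← h₁, Matrix.det_one_add_mul_comm, h₂, add_zero, Matrix.det_one]

section Reduction

variable {ι R : Type*} [Fintype ι] [DecidableEq ι] [CommRing R]
  (o e : ι → Prop) [DecidablePred o] [DecidablePred e]

/-- The matrix obtained from `x • 1 - B` by eliminating the indices satisfying `e`, which
couple only to the indices satisfying `o`. -/
def reducedMatrix (x : R) (B : Matrix ι ι R) : Matrix ι ι R :=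
  of fun i j =>
    if e i ∨ e j then (1 : Matrix ι ι R) i j
    else (x * (1 : Matrix ι ι R) i j - B i j) * (if o j then x else 1) -
      if o j then ∑ k with e k, B i k * B k j else 0

lemma pow_mul_det_eq_pow_mul_det_reducedMatrix (hoe : ∀ i, o i → ¬ e i) (x : R)
    (B : Matrix ι ι R) (h₁ : ∀ i j, e i → ¬ o j → B i j = 0)
    (h₂ : ∀ i j, e j → ¬ o i → B i j = 0) :
    x ^ (Finset.univ.filter o).card * (x • (1 : Matrix ι ι R) - B).det =
      x ^ (Finset.univ.filter e).card * (reducedMatrix o e x B).det := by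
  let A : Matrix ι ι R := of fun i j => if e i ∧ o j then B i j else 0
  let Z : Matrix ι ι R := of fun i j => if o i ∧ e j then - B i j else 0
  have hA : (1 + A).det = 1 := by
    apply Matrix.det_one_add_eq_one (D := diagonal fun i => if o i then 1 else 0)
    · ext i j; simp [A]; tauto
    · ext i j
      have := hoe i
      simp [A]; tauto
  have hZ : (1 + Z).det = 1 := by
    apply Matrix.det_one_add_eq_one (D := diagonal fun i => if e i then 1 else 0)
    · ext i j; simp [Z]; tauto
    · ext i j
      have := hoe i
      simp [Z]; tauto
  have key : (x • (1 : Matrix ι ι R) - B) * diagonal (fun i => if o i then x else 1) * (1 + A) =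
      diagonal (fun i => if e i then x else 1) * ((1 + Z) * reducedMatrix o e x B) := by
    ext i j
    rw [diagonal_mul, mul_add, add_mul, mul_one, one_mul, Matrix.add_apply, Matrix.add_apply,
      mul_diagonal, mul_apply, mul_apply]
    simp only [mul_diagonal]
    have hs1 : ∑ k, (x • (1 : Matrix ι ι R) - B) i k * (if o k then x else 1) * A k j =
        if o j then (if e i then x * B i j else 0) - ∑ k with e k, B i k * B k j else 0 := by
      by_cases hj : o j
      · have hk : ∀ k, (x • (1 : Matrix ι ι R) - B) i k * (if o k then x else 1) * A k j =
            (if i = k then (if e k then x * B k j else 0) else 0) -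
              if e k then B i k * B k j else 0 := by
          intro k
          by_cases hek : e k
          · have hok : ¬ o k := fun h => hoe k h hek
            by_cases hik : i = k <;> simp [A, hj, hek, hok, hik, one_apply, sub_mul]
          · simp [A, hek]
        rw [Finset.sum_congr rfl fun k _ => hk k, Finset.sum_sub_distrib, Finset.sum_filter]
        simp [hj]
      · simp [A, hj]
    have hs2 : ∑ k, Z i k * reducedMatrix o e x B k j = if o i ∧ e j then - B i j else 0 := by
      split_ifs with h
      · rw [Finset.sum_eq_single j]
        · simp [Z, h, reducedMatrix]
        · intro k _ hk
          by_cases hek : e k <;> simp [Z, hek, reducedMatrix, one_apply_ne hk]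
        · simp
      · refine Finset.sum_eq_zero fun k _ => ?_
        by_cases hek : o i ∧ e k
        · have hej : ¬ e j := fun hej => h ⟨hek.1, hej⟩
          have hkj : k ≠ j := fun hkj => hej (hkj ▸ hek.2)
          simp [reducedMatrix, hek, one_apply_ne hkj]
        · simp [Z, hek]
    rw [hs1, hs2]
    have hs3 : ¬ o i → ∑ k with e k, B i k * B k j = 0 := fun h =>
      Finset.sum_eq_zero fun k hk => by rw [h₂ i k (by simpa using hk) h, zero_mul]
    have hi := hoe i
    have hj := hoe j
    have hij₁ := h₁ i j
    have hij₂ := h₂ i j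
    simp only [reducedMatrix, of_apply, Matrix.sub_apply, Matrix.smul_apply, smul_eq_mul]
    by_cases hij : i = j
    · subst hij
      rw [one_apply_eq]
      grind
    · rw [one_apply_ne hij]
      grind
  have := congrArg det key
  simp only [det_mul, hA, hZ, det_diagonal, Finset.prod_ite, Finset.prod_const, one_pow,
    mul_one, one_mul] at this
  rw [mul_comm, this]

end Reduction

lemma map_reducedMatrix {ι R S : Type*} [Fintype ι] [DecidableEq ι] [CommRing R] [CommRing S]
    (o e : ι → Prop) [DecidablePred o] [DecidablePred e] (f : R →+* S) (x : R)
    (B : Matrix ι ι R) :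
    (reducedMatrix o e x B).map f = reducedMatrix o e (f x) (B.map f) := by
  ext i j
  simp only [reducedMatrix, map_apply, of_apply, one_apply]
  split_ifs <;> simp

lemma neg_one_pow_posRootCount_charpoly_mul_det_reducedMatrix_pos {ι : Type*} [Fintype ι]
    [DecidableEq ι] (o e : ι → Prop) [DecidablePred o] [DecidablePred e]
    (hoe : ∀ i, o i → ¬ e i) (B : Matrix ι ι ℝ) (h₁ : ∀ i j, e i → ¬ o j → B i j = 0)
    (h₂ : ∀ i j, e j → ¬ o i → B i j = 0) (h0 : (reducedMatrix o e 0 B).det ≠ 0) :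
    0 < (-1) ^ posRootCount B.charpoly * (reducedMatrix o e 0 B).det := by
  set q : ℝ[X] := (reducedMatrix o e X (B.map (C : ℝ →+* ℝ[X]))).det with hq
  have hq0 : q.eval 0 = (reducedMatrix o e 0 B).det := by
    rw [hq, ← coe_evalRingHom, RingHom.map_det, RingHom.mapMatrix_apply, map_reducedMatrix]
    congr 2
    · simp
    · ext i j; simp
  have hchar : B.charpoly = ((X : ℝ[X]) • (1 : Matrix ι ι ℝ[X]) - B.map (C : ℝ →+* ℝ[X])).det := by
    rw [Matrix.charpoly, charmatrix, scalar_apply, smul_one_eq_diagonal]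
    rfl
  have key := pow_mul_det_eq_pow_mul_det_reducedMatrix o e hoe X (B.map (C : ℝ →+* ℝ[X]))
    (fun i j hi hj => by simp [h₁ i j hi hj]) (fun i j hi hj => by simp [h₂ i j hi hj])
  rw [← hchar, ← hq] at key
  have hmonic : q.Monic := by
    refine (monic_X_pow (Finset.univ.filter e).card).of_mul_monic_left ?_
    rw [← key]
    exact (monic_X_pow _).mul B.charpoly_monic
  have hcount := congrArg posRootCount key
  rw [posRootCount_mul (pow_ne_zero _ X_ne_zero) B.charpoly_monic.ne_zero,
    posRootCount_mul (pow_ne_zero _ X_ne_zero) hmonic.ne_zero, posRootCount_X_pow,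
    posRootCount_X_pow, zero_add, zero_add] at hcount
  rw [hcount, ← hq0]
  exact neg_one_pow_posRootCount_mul_eval_zero_pos q hmonic (hq0 ▸ h0)

lemma det_of_support_subset_perm {ι R : Type*} [Fintype ι] [DecidableEq ι] [CommRing R]
    (σ : Equiv.Perm ι) (M : Matrix ι ι R) (h : ∀ i j, j ≠ σ i → M i j = 0) :
    M.det = σ.sign * ∏ i, M i (σ i) := by
  have : M = diagonal (fun i => M i (σ i)) * σ.permMatrix R := by
    ext i j
    rw [diagonal_mul, Equiv.Perm.permMatrix, PEquiv.toMatrix_apply]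
    by_cases hj : j = σ i
    · simp [hj]
    · simp [h i j hj, Ne.symm hj]
  rw [this, det_mul, det_permutation, det_diagonal, mul_comm]
  simp [PEquiv.toMatrix_apply, Equiv.Perm.permMatrix]

section Core

variable {ι : Type*} [Fintype ι] [DecidableEq ι] (o e : ι → Prop) [DecidablePred o]
  [DecidablePred e] (m : ι → ι) (τ : Equiv.Perm ι)

/-- The weight is `1` on the arcs of the permutation `τ` outside `o` and `e` and on the arcs
between `i` and `m i` for `i` satisfying `o`; it is `ε` elsewhere. -/
def arcWeight (ε : ℝ) (i j : ι) : ℝ :=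
  if (¬ o i ∧ ¬ e i ∧ j = τ i) ∨ (o i ∧ j = m i) ∨ (o j ∧ i = m j) then 1 else ε

lemma det_reducedMatrix_arcWeight_zero (hoe : ∀ i, o i → ¬ e i) (A : Matrix ι ι ℝ)
    (hm : ∀ i, o i → e (m i)) (hinj : ∀ i j, o i → o j → m i = m j → i = j)
    (hτ : ∀ i, o i ∨ e i → τ i = i) :
    (reducedMatrix o e 0 (of fun i j => A i j * arcWeight o e m τ 0 i j)).det =
      τ.sign * ∏ i, if e i then 1 else if o i then - (A i (m i) * A (m i) i) else - A i (τ i) := by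
  have hτ' : ∀ i, o (τ i) ∨ e (τ i) → τ i = i := fun i h => τ.injective (hτ _ h)
  have hsum : ∀ i, o i → ∑ k with e k, A i k * arcWeight o e m τ 0 i k *
      (A k i * arcWeight o e m τ 0 k i) = A i (m i) * A (m i) i := by
    intro i hi
    rw [Finset.sum_eq_single (m i)]
    · simp [arcWeight, hi]
    · intro k hk hkm
      have hek : e k := by simpa using hk
      have hok : ¬ o k := fun h => hoe k h hek
      simp [arcWeight, hi, hok, hkm]
    · simp [hm i hi]
  rw [det_of_support_subset_perm τ]
  · congr 1
    refine Finset.prod_congr rfl fun i _ => ?_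
    by_cases hei : e i
    · simp [reducedMatrix, hei, hτ i (Or.inr hei)]
    by_cases hoi : o i
    · simp only [reducedMatrix, of_apply, hei, hoi, hτ i (Or.inl hoi), hsum i hoi]
      simp
    · have hi : ¬ o (τ i) ∧ ¬ e (τ i) := by
        constructor <;> intro h <;> have := hτ' i (by tauto) <;> rw [this] at h <;> contradiction
      simp [reducedMatrix, hei, hoi, hi, arcWeight]
  · intro i j hij
    by_cases hE : e i ∨ e j
    · have : i ≠ j := by
        rintro rfl
        exact hij (hτ i (Or.inr (by tauto))).symm
      simp [reducedMatrix, hE, one_apply_ne this]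
    by_cases hoj : o j
    · have : i ≠ j := by
        rintro rfl
        exact hij (hτ i (Or.inl hoj)).symm
      simp only [reducedMatrix, of_apply, if_neg hE, if_pos hoj]
      rw [Finset.sum_eq_zero]
      · simp
      intro k hk
      have hek : e k := by simpa using hk
      have hok : ¬ o k := fun h => hoe k h hek
      by_cases hkj : k = m j
      · have hki : ¬ (o i ∧ k = m i) := fun h => this (hinj i j h.1 hoj (h.2 ▸ hkj))
        have hki' : ¬ (¬ o i ∧ k = τ i) := by
          rintro ⟨h1, rfl⟩
          have := hτ' i (Or.inr hek)
          rw [this] at hek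
          tauto
        have : arcWeight o e m τ 0 i k = 0 := by
          rw [arcWeight, if_neg]; tauto
        simp [this]
      · have : arcWeight o e m τ 0 k j = 0 := by
          rw [arcWeight, if_neg]; tauto
        simp [this]
    · have : arcWeight o e m τ 0 i j = 0 := by
        rw [arcWeight, if_neg]
        rintro (h | ⟨h, rfl⟩ | h)
        · exact hij h.2.2
        · exact hE (Or.inr (hm i h))
        · exact hoj h.1
      simp [reducedMatrix, hE, hoj, this]

lemma continuous_det_reducedMatrix_arcWeight (A : Matrix ι ι ℝ) :
    Continuous fun ε =>
      (reducedMatrix o e 0 (of fun i j => A i j * arcWeight o e m τ ε i j)).det := by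
  have hw : ∀ i j, Continuous fun ε => arcWeight o e m τ ε i j := by
    intro i j
    unfold arcWeight
    split_ifs <;> fun_prop
  refine Continuous.matrix_det (continuous_matrix fun i j => ?_)
  simp only [reducedMatrix, of_apply]
  split_ifs <;> fun_prop

lemma det_mul_det_reducedMatrix_arcWeight_zero_neg (hoe : ∀ i, o i → ¬ e i)
    (A : Matrix ι ι ℝ) (hm : ∀ i, o i → e (m i) ∧ A i (m i) ≠ 0 ∧ A (m i) i ≠ 0)
    (hinj : ∀ i j, o i → o j → m i = m j → i = j) (hτ : ∀ i, o i ∨ e i → τ i = i)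
    (hprod : ∏ i with ¬ o i ∧ ¬ e i, A i (τ i) * A (τ i) i < 0) :
    (reducedMatrix o e 0 (of fun i j => A i j * arcWeight o e m τ 0 i j)).det *
      (reducedMatrix o e 0 (of fun i j => A i j * arcWeight o e m τ⁻¹ 0 i j)).det < 0 := by
  have hτinv : ∀ i, o i ∨ e i → τ⁻¹ i = i := fun i h => by
    rw [Equiv.Perm.inv_eq_iff_eq, hτ i h]
  have hτ' : ∀ i, o (τ i) ∨ e (τ i) → τ i = i := fun i h => τ.injective (hτ _ h)
  rw [det_reducedMatrix_arcWeight_zero o e m τ hoe A (fun i h => (hm i h).1) hinj hτ,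
    det_reducedMatrix_arcWeight_zero o e m τ⁻¹ hoe A (fun i h => (hm i h).1) hinj hτinv,
    ← Equiv.prod_comp τ (fun i => if e i then (1 : ℝ) else if o i then - (A i (m i) * A (m i) i)
      else - A i (τ⁻¹ i))]
  have hsign : ((τ.sign : ℤ) : ℝ) * ((τ⁻¹.sign : ℤ) : ℝ) = 1 := by
    rw [Equiv.Perm.sign_inv, ← Int.cast_mul, ← Units.val_mul, Int.units_mul_self]
    simp
  rw [mul_mul_mul_comm, hsign, one_mul, ← Finset.prod_mul_distrib,
    ← Finset.prod_filter_mul_prod_filter_not Finset.univ (fun i => ¬ o i ∧ ¬ e i)]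
  refine mul_neg_of_neg_of_pos (lt_of_eq_of_lt ?_ hprod) (Finset.prod_pos fun i hi => ?_)
  · apply Finset.prod_congr rfl
    intro i hi
    have hi : ¬ o i ∧ ¬ e i := by simpa using hi
    have hi' : ¬ o (τ i) ∧ ¬ e (τ i) := by
      have := hτ' i
      constructor <;> intro h <;> have := hτ' i (by tauto) <;> rw [this] at h <;> tauto
    simp [hi, hi']
  · have hi : o i ∨ e i := by
      have := (Finset.mem_filter.1 hi).2
      tauto
    rw [hτ i hi]
    by_cases hei : e i
    · simp [hei]
    · have hoi : o i := by tauto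
      have := hm i hoi
      simp only [hei, hoi, if_true, if_false]
      exact mul_self_pos.2 (neg_ne_zero.2 (mul_ne_zero this.2.1 this.2.2))

end Core

lemma exists_inertia_ne_of_perm {n : ℕ} (P : Matrix (Fin n) (Fin n) SignType)
    (o e : Fin n → Prop) (hoe : ∀ i, o i → ¬ e i)
    (h₁ : ∀ i j, e i → ¬ o j → P i j = 0) (h₂ : ∀ i j, e j → ¬ o i → P i j = 0)
    (m : Fin n → Fin n) (hm : ∀ i, o i → e (m i) ∧ P i (m i) ≠ 0 ∧ P (m i) i ≠ 0)
    (hinj : ∀ i j, o i → o j → m i = m j → i = j)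
    (σ : Equiv.Perm (Fin n)) (hσ : ∀ i, o i ∨ e i → σ i = i)
    (s : Finset (Fin n)) (hs : ∀ i, i ∈ s ↔ ¬ o i ∧ ¬ e i)
    (hprod : ∏ i ∈ s, P i (σ i) * P (σ i) i = -1) :
    ∃ B₁ B₂, QClass P B₁ ∧ QClass P B₂ ∧ inertia B₁ ≠ inertia B₂ := by
  classical
  let A : Matrix (Fin n) (Fin n) ℝ := of fun i j => (P i j : ℝ)
  have hA : ∀ i j, A i j = 0 ↔ P i j = 0 := by
    intro i j
    simp only [A, of_apply]
    cases P i j <;> simp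
  let B (τ : Equiv.Perm (Fin n)) (ε : ℝ) : Matrix (Fin n) (Fin n) ℝ :=
    of fun i j => A i j * arcWeight o e m τ ε i j
  have hQ : ∀ τ ε, 0 < ε → QClass P (B τ ε) := by
    intro τ ε hε i j
    have hw : 0 < arcWeight o e m τ ε i j := by
      unfold arcWeight; split_ifs <;> positivity
    simp only [B, of_apply, sign_mul, sign_pos hw, mul_one, A]
    cases P i j <;> simp
  have hneg := det_mul_det_reducedMatrix_arcWeight_zero_neg o e m σ hoe A
    (fun i h => by simpa [hA] using hm i h) hinj hσ (by
      have : Finset.univ.filter (fun i => ¬ o i ∧ ¬ e i) = s := by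
        ext i; simp [hs]
      rw [this]
      have := congrArg (SignType.castHom (α := ℝ)) hprod
      rw [map_prod] at this
      simp only [map_mul] at this
      have h1 : SignType.castHom (α := ℝ) (-1) = -1 := by simp
      rw [h1] at this
      exact this.trans_lt (by norm_num))
  have hev := (((continuous_det_reducedMatrix_arcWeight o e m σ A).mul
    (continuous_det_reducedMatrix_arcWeight o e m σ⁻¹ A)).tendsto 0).eventually_lt_const hneg
  obtain ⟨ε, hlt, hε⟩ := ((hev.filter_mono nhdsWithin_le_nhds).and
    (self_mem_nhdsWithin (a := (0 : ℝ)) (s := Set.Ioi 0))).exists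
  refine ⟨B σ ε, B σ⁻¹ ε, hQ _ _ hε, hQ _ _ hε, fun hin => ?_⟩
  have hcount : posRootCount (B σ ε).charpoly = posRootCount (B σ⁻¹ ε).charpoly :=
    congrArg Prod.fst hin
  have hpos (τ) := neg_one_pow_posRootCount_charpoly_mul_det_reducedMatrix_pos o e hoe (B τ ε)
    (fun i j hi hj => by simp [B, (hA i j).2 (h₁ i j hi hj)])
    (fun i j hi hj => by simp [B, (hA i j).2 (h₂ i j hi hj)])
  have hp₁ := hpos σ (left_ne_zero_of_mul hlt.ne)
  have hp₂ := hpos σ⁻¹ (right_ne_zero_of_mul hlt.ne)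
  have := mul_pos hp₁ hp₂
  rw [hcount, mul_mul_mul_comm, ← pow_add, Even.neg_one_pow ⟨_, rfl⟩, one_mul] at this
  exact lt_asymm hlt this

lemma SimpleGraph.Walk.IsCycle.exists_perm_s19 {V : Type*} {G : SimpleGraph V} {v : V}
    {c : G.Walk v v} (hc : c.IsCycle) :
    ∃ σ : Equiv.Perm V, (∀ i, i ∉ c.support → σ i = i) ∧
      c.edges = c.support.dropLast.map (fun i => s(i, σ i)) := by
  classical
  refine ⟨c.support.dropLast.formPerm, fun i hi => List.formPerm_apply_of_notMem
    fun h => hi (List.mem_of_mem_dropLast h), ?_⟩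
  refine List.ext_getElem (by simp) fun i h₁ h₂ => ?_
  have hi : i < c.length := by simpa using h₁
  have hpos : 0 < c.length := by omega
  rw [List.getElem_map, List.formPerm_apply_getElem _ hc.nodup_dropLast_support,
    SimpleGraph.Walk.getElem_edges]
  simp only [List.length_dropLast, SimpleGraph.Walk.length_support, Nat.add_sub_cancel,
    List.getElem_dropLast, SimpleGraph.Walk.support_getElem_eq_getVert]
  rcases Nat.lt_or_ge (i + 1) c.length with h | h
  · rw [Nat.mod_eq_of_lt h]
  · have : i + 1 = c.length := by omega
    simp [this]

lemma SimpleGraph.Walk.IsCycle.mem_dropLast_support {V : Type*} {G : SimpleGraph V} {u v : V}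
    {c : G.Walk v v} (hc : c.IsCycle) : u ∈ c.support.dropLast ↔ u ∈ c.support := by
  refine ⟨List.mem_of_mem_dropLast, fun h => ?_⟩
  rw [← c.tail_support_perm_dropLast_support.mem_iff]
  rcases c.mem_support_iff.1 h with rfl | h
  · exact c.end_mem_tail_support hc.not_nil
  · exact h

lemma List.prod_map_eq_neg_one_pow_countP {α : Type*} (f : α → SignType) (l : List α)
    (h : ∀ a ∈ l, f a ≠ 0) :
    (l.map f).prod = (-1) ^ l.countP (fun a => decide (f a = SignType.neg)) := by
  induction l with
  | nil => simp
  | cons a l ih =>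
    have ha := h a (by simp)
    rw [List.map_cons, List.prod_cons, ih fun b hb => h b (by simp [hb]), List.countP_cons]
    cases hfa : f a
    · exact absurd hfa ha
    · simp [pow_succ, mul_comm]
    · simp

lemma patternGraph_adj {n : ℕ} {P : Matrix (Fin n) (Fin n) SignType} (hdiag : ∀ i, P i i = 0)
    (hsym : ∀ i j, P i j ≠ 0 ↔ P j i ≠ 0) (i j : Fin n) :
    (patternGraph P).Adj i j ↔ P i j ≠ 0 := by
  rw [patternGraph, SimpleGraph.fromRel_adj, ← hsym i j, or_self, and_iff_right_iff_imp]
  rintro h rfl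
  exact h (hdiag i)

/-- A vertex off the vertex set `s` has a neighbour that is one step closer to `s`. -/
lemma SimpleGraph.Connected.exists_adj_sInf_dist {V : Type*} {G : SimpleGraph V}
    (hG : G.Connected) (s : Set V) (hs : s.Nonempty) {u : V} (hu : u ∉ s) :
    ∃ w, G.Adj u w ∧ sInf {d : ℕ | ∃ x ∈ s, G.dist u x = d} =
      sInf {d : ℕ | ∃ x ∈ s, G.dist w x = d} + 1 := by
  have hne : ∀ u, {d : ℕ | ∃ x ∈ s, G.dist u x = d}.Nonempty := fun u =>
    ⟨_, hs.some, hs.some_mem, rfl⟩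
  obtain ⟨x, hx, hxd⟩ := Nat.sInf_mem (hne u)
  obtain ⟨p, hp⟩ := hG.exists_walk_length_eq_dist u x
  cases p with
  | nil => exact absurd hx hu
  | @cons _ w _ h p =>
    refine ⟨w, h, le_antisymm ?_ ?_⟩
    · obtain ⟨y, hy, hyd⟩ := Nat.sInf_mem (hne w)
      have h1 : sInf {d : ℕ | ∃ x ∈ s, G.dist u x = d} ≤ G.dist u y := Nat.sInf_le ⟨y, hy, rfl⟩
      have := hG.dist_triangle (u := u) (v := w) (w := y)
      have := SimpleGraph.dist_eq_one_iff_adj.2 h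
      omega
    · have h1 : sInf {d : ℕ | ∃ x ∈ s, G.dist w x = d} ≤ G.dist w x := Nat.sInf_le ⟨x, hx, rfl⟩
      have h2 := SimpleGraph.dist_le p
      rw [SimpleGraph.Walk.length_cons] at hp
      omega

/-- In a connected unicyclic graph every edge is a cycle edge or joins a vertex off the cycle
to its parent. -/
lemma SimpleGraph.Walk.IsCycle.mem_edges_or_eq_parent {V : Type*} [Fintype V]
    {G : SimpleGraph V} {v : V} {c : G.Walk v v} (hc : c.IsCycle)
    (hedges : G.edgeSet.ncard = Fintype.card V) (d : V → ℕ) (par : V → V)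
    (hadj : ∀ u, u ∉ c.support → G.Adj u (par u))
    (hd : ∀ u, u ∉ c.support → d u = d (par u) + 1) {a b : V} (hab : G.Adj a b) :
    s(a, b) ∈ c.edges ∨ (a ∉ c.support ∧ par a = b) ∨ (b ∉ c.support ∧ par b = a) := by
  classical
  set S : Finset V := c.support.toFinset with hS
  have hmem : ∀ u, u ∈ Sᶜ ↔ u ∉ c.support := by simp [hS]
  set T : Finset (Sym2 V) := Sᶜ.image fun u => s(u, par u) with hT
  have hScard : S.card = c.length := by
    have : S = c.support.dropLast.toFinset := by
      ext u
      rw [hS, List.mem_toFinset, List.mem_toFinset, hc.mem_dropLast_support]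
    rw [this, List.toFinset_card_of_nodup hc.nodup_dropLast_support]
    simp
  have hTcard : T.card = Sᶜ.card := by
    refine Finset.card_image_of_injOn fun x hx y hy hxy => ?_
    have h1 := hd x ((hmem x).1 hx)
    have h2 := hd y ((hmem y).1 hy)
    rcases Sym2.eq_iff.1 hxy with h | ⟨h, h'⟩
    · exact h.1
    · rw [h'] at h1
      rw [← h] at h2
      omega
  have hdisj : Disjoint c.edges.toFinset T := by
    rw [Finset.disjoint_right]
    intro ed hed hed'
    obtain ⟨u, hu, rfl⟩ := Finset.mem_image.1 hed
    exact (hmem u).1 hu (c.fst_mem_support_of_mem_edges (List.mem_toFinset.1 hed'))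
  have hsub : ((c.edges.toFinset ∪ T : Finset (Sym2 V)) : Set (Sym2 V)) ⊆ G.edgeSet := by
    intro ed hed
    rcases Finset.mem_union.1 (Finset.mem_coe.1 hed) with h | h
    · exact c.edges_subset_edgeSet (List.mem_toFinset.1 h)
    · obtain ⟨u, hu, rfl⟩ := Finset.mem_image.1 h
      exact hadj u ((hmem u).1 hu)
  have hall : ((c.edges.toFinset ∪ T : Finset (Sym2 V)) : Set (Sym2 V)) = G.edgeSet := by
    refine Set.eq_of_subset_of_ncard_le hsub ?_ (Set.toFinite _)
    rw [hedges, Set.ncard_coe_finset, Finset.card_union_of_disjoint hdisj, hTcard,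
      List.toFinset_card_of_nodup hc.edges_nodup, SimpleGraph.Walk.length_edges, ← hScard,
      Finset.card_add_card_compl]
  have : s(a, b) ∈ G.edgeSet := hab
  rw [← hall, Finset.mem_coe, Finset.mem_union, List.mem_toFinset] at this
  refine this.imp_right fun h => ?_
  obtain ⟨u, hu, huab⟩ := Finset.mem_image.1 h
  have hu := (hmem u).1 hu
  rcases Sym2.eq_iff.1 huab with ⟨rfl, rfl⟩ | ⟨rfl, rfl⟩
  · exact Or.inl ⟨hu, rfl⟩
  · exact Or.inr ⟨hu, rfl⟩

/-- Let `P` be a combinatorially symmetric sign pattern with `0`-diagonal whose underlying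
graph `G` is connected with exactly `n` edges (unicyclic), `c` a cycle in `G`, and suppose
every leaf of `G` is at even distance from the cycle.  If the number of negative edges of
the cycle is odd, then `P` does not require a unique inertia. -/
theorem unicyclic_odd_negative_cycle_not_unique_inertia (n : ℕ)
    (P : Matrix (Fin n) (Fin n) SignType)
    (hdiag : ∀ i, P i i = 0)
    (hsym : ∀ i j, P i j ≠ 0 ↔ P j i ≠ 0)
    (hconn : (patternGraph P).Connected)
    (hedges : (patternGraph P).edgeSet.ncard = n)
    (v : Fin n) (c : (patternGraph P).Walk v v) (hc : c.IsCycle)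
    (hleaf : ∀ u : Fin n, ((patternGraph P).neighborSet u).ncard = 1 →
      Even (sInf {d : ℕ | ∃ w ∈ c.support, (patternGraph P).dist u w = d}))
    (hoddneg : Odd (c.edges.countP (fun ed => decide (edgeSign P ed = SignType.neg)))) :
    ∃ B₁ B₂, QClass P B₁ ∧ QClass P B₂ ∧ inertia B₁ ≠ inertia B₂ := by
  have hadj := patternGraph_adj hdiag hsym
  obtain ⟨σ, hσ, hedges_eq⟩ := hc.exists_perm_s19
  let d : Fin n → ℕ := fun u => sInf {d : ℕ | ∃ w ∈ c.support, (patternGraph P).dist u w = d}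
  have hd0 : ∀ u ∈ c.support, d u = 0 := fun u hu =>
    Nat.sInf_eq_zero.2 (Or.inl ⟨u, hu, SimpleGraph.dist_self⟩)
  choose! par hpar_adj hpar using fun u (hu : u ∉ c.support) =>
    hconn.exists_adj_sInf_dist {w | w ∈ c.support} ⟨v, c.start_mem_support⟩ hu
  change ∀ u, u ∉ c.support → d u = d (par u) + 1 at hpar
  have hcases : ∀ a b, P a b ≠ 0 → (a ∈ c.support ∧ b ∈ c.support) ∨
      (a ∉ c.support ∧ par a = b) ∨ (b ∉ c.support ∧ par b = a) := fun a b hab =>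
    (hc.mem_edges_or_eq_parent (by simpa using hedges) d par hpar_adj hpar
      ((hadj a b).2 hab)).imp_left fun h =>
        ⟨c.fst_mem_support_of_mem_edges h, c.snd_mem_support_of_mem_edges h⟩
  have hodd : ∀ i j, Even (d i) → i ∉ c.support → P i j ≠ 0 → Odd (d j) := by
    intro i j hi hic hij
    rcases hcases i j hij with h | ⟨h, rfl⟩ | ⟨h, rfl⟩
    · exact absurd h.1 hic
    · rw [hpar i h] at hi
      exact Nat.not_even_iff_odd.1 fun h => Nat.not_even_iff_odd.2 h.add_one hi
    · rw [hpar j h]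
      exact hi.add_one
  have hchild : ∀ i, Odd (d i) → ∃ w, (w ∉ c.support ∧ par w = i) := by
    intro i hi
    by_contra! hno
    have hic : i ∉ c.support := fun h => by simp [hd0 i h] at hi
    have hset : (patternGraph P).neighborSet i = {par i} := by
      ext w
      rw [SimpleGraph.mem_neighborSet, Set.mem_singleton_iff]
      refine ⟨fun h => ?_, fun h => h ▸ hpar_adj i hic⟩
      rcases hcases i w ((hadj i w).1 h) with h | h | h
      · exact absurd h.1 hic
      · exact h.2.symm
      · exact absurd h.2 (hno w h.1)
    exact Nat.not_even_iff_odd.2 hi (hleaf i (by rw [hset, Set.ncard_singleton]))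
  choose! m hm_notMem hm_par using hchild
  refine exists_inertia_ne_of_perm P (fun i => Odd (d i)) (fun i => Even (d i) ∧ i ∉ c.support)
    (fun i h h' => Nat.not_even_iff_odd.2 h h'.1) ?_ ?_ m ?_ ?_ σ ?_ c.support.dropLast.toFinset
    ?_ ?_
  · rintro i j ⟨hi, hic⟩ hj
    by_contra hne
    exact hj (hodd i j hi hic hne)
  · rintro i j ⟨hj, hjc⟩ hi
    by_contra hne
    exact hi (hodd j i hj hjc ((hsym i j).1 hne))
  · intro i hi
    have hic := hm_notMem i hi
    have h1 := hpar (m i) hic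
    have h2 := (hadj _ _).1 (hpar_adj (m i) hic)
    rw [hm_par i hi] at h1 h2
    exact ⟨⟨h1 ▸ hi.add_one, hic⟩, (hsym _ _).1 h2, h2⟩
  · intro i j hi hj hij
    rw [← hm_par i hi, hij, hm_par j hj]
  · rintro i (hi | hi)
    · exact hσ i fun h => by simp [hd0 i h] at hi
    · exact hσ i hi.2
  · intro i
    rw [List.mem_toFinset, hc.mem_dropLast_support, ← Nat.not_even_iff_odd]
    have := hd0 i
    grind
  · rw [List.prod_toFinset _ hc.nodup_dropLast_support]
    have := List.prod_map_eq_neg_one_pow_countP (edgeSign P) c.edges ?_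
    · rw [hoddneg.neg_one_pow, hedges_eq, List.map_map] at this
      exact this
    · intro ed
      induction ed with
      | _ a b =>
        intro h
        have := (hadj a b).1 (c.edges_subset_edgeSet h)
        exact mul_ne_zero this ((hsym a b).1 this)
end
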